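/- Assume n > 1. Let H ⊆ GL_n(k) be an algebraic subgroup whose triangular representation is bounded by d, let H' ⊆ GL_l(k) be an algebraic subgroup whose triangular representation is bounded by d', and let τ : H → GL_l(k) be a homomorphism bounded by m. Then the algebraic subgroup τ⁻¹(H' ∩ τ(H)) of GL_n(k) has a triangular representation bounded by n·(max(d, m·d'))^{5.5n³}. -/

import Mathlib

open MvPolynomial Matrix Pointwise

section TriSets

variable {k : Type*} [Field k] {σ : Type*} [LinearOrder σ]

noncomputable def leadCoeff (c : σ) (g : MvPolynomial σ k) : MvPolynomial σ k :=
  (g.support.filter fun m => m c = g.degreeOf c).sum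
    fun m => monomial (Finsupp.erase c m) (g.coeff m)

def IsTriangularSet (G : List (MvPolynomial σ k)) : Prop :=
  (∀ g ∈ G, g.vars.Nonempty) ∧
  G.Chain' fun g h => g.vars.max < h.vars.max

def IsPseudoRem (G : List (MvPolynomial σ k)) (f r : MvPolynomial σ k) : Prop :=
  ∃ (c : Fin G.length → σ) (α : Fin G.length → ℕ) (q : Fin G.length → MvPolynomial σ k),
    (∀ i, (G.get i).vars.max = (c i : WithBot σ)) ∧
    (∏ i, leadCoeff (c i) (G.get i) ^ α i) * f = (∑ i, q i * G.get i) + r ∧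
    ∀ i, r.degreeOf (c i) < (G.get i).degreeOf (c i)

def trep (G : List (MvPolynomial σ k)) : Set (MvPolynomial σ k) :=
  {f | IsPseudoRem G f 0}

def HasTriRepBoundedBy (I : Ideal (MvPolynomial σ k)) (D : ℝ) : Prop :=
  ∃ (N : ℕ) (G : Fin (N + 1) → List (MvPolynomial σ k)),
    (∀ i, IsTriangularSet (G i)) ∧
    (∀ i, ∀ g ∈ G i, (g.totalDegree : ℝ) ≤ D) ∧
    (∀ i, ∃ J : Ideal (MvPolynomial σ k), J.IsRadical ∧ (J : Set (MvPolynomial σ k)) = trep (G i)) ∧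
    (I.radical : Set (MvPolynomial σ k)) = ⋂ i, trep (G i)

end TriSets

section GLdefs

variable {k : Type*} [Field k]

noncomputable def evalMat {n : ℕ} (g : GL (Fin n) k) : (Fin n ×ₗ Fin n) → k :=
  fun p => (g : Matrix (Fin n) (Fin n) k) (ofLex p).1 (ofLex p).2

def IsZeroSetOf {n : ℕ} (S : Set (MvPolynomial (Fin n ×ₗ Fin n) k))
    (H : Subgroup (GL (Fin n) k)) : Prop :=
  ∀ g : GL (Fin n) k, g ∈ H ↔ ∀ p ∈ S, eval (evalMat g) p = 0

def IsAlgebraicSubgroup {n : ℕ} (H : Subgroup (GL (Fin n) k)) : Prop :=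
  ∃ S : Finset (MvPolynomial (Fin n ×ₗ Fin n) k), IsZeroSetOf (S : Set _) H

/-- `H` is an algebraic subgroup whose defining ideal has a triangular
representation bounded by `D`. -/
def SubgroupTriRepBoundedBy {n : ℕ} (H : Subgroup (GL (Fin n) k)) (D : ℝ) : Prop :=
  ∃ S : Finset (MvPolynomial (Fin n ×ₗ Fin n) k),
    IsZeroSetOf (S : Set (MvPolynomial (Fin n ×ₗ Fin n) k)) H ∧
    HasTriRepBoundedBy (Ideal.span (S : Set (MvPolynomial (Fin n ×ₗ Fin n) k))) D

def IsUnipotent {n : ℕ} (g : GL (Fin n) k) : Prop :=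
  ((g : Matrix (Fin n) (Fin n) k) - 1) ^ n = 0

/-- The Zariski topology on `GL_n(k)`: closed sets are zero sets of families of
polynomials in the matrix entries. -/
def zariskiGL (n : ℕ) (k : Type*) [Field k] : TopologicalSpace (GL (Fin n) k) :=
  TopologicalSpace.generateFrom
    {U | ∃ S : Set (MvPolynomial (Fin n ×ₗ Fin n) k),
      U = {g | ∃ p ∈ S, eval (evalMat g) p ≠ 0}}

/-- The identity component `H°` of a subgroup `H ⊆ GL_n(k)`: the connected component of
the identity in `H` for the (subspace) Zariski topology, viewed as a subset of `GL_n(k)`. -/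
noncomputable def idComponent {n : ℕ} (H : Subgroup (GL (Fin n) k)) : Set (GL (Fin n) k) :=
  letI := zariskiGL n k
  Subtype.val '' connectedComponent (⟨1, H.one_mem⟩ : H)

end GLdefs

/-- A homomorphism `τ : H → GL_l(k)` of algebraic groups is bounded by `m` if it is given by
`(P_{i,j}/Q)` for polynomials `P_{i,j}, Q` in the source matrix entries of degree at most `m`. -/
def HomBoundedBy {k : Type*} [Field k] {n l : ℕ} {H : Subgroup (GL (Fin n) k)}
    (τ : H →* GL (Fin l) k) (m : ℕ) : Prop :=
  ∃ (P : Fin l → Fin l → MvPolynomial (Fin n ×ₗ Fin n) k)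
    (Q : MvPolynomial (Fin n ×ₗ Fin n) k),
    (∀ i j, (P i j).totalDegree ≤ m) ∧ Q.totalDegree ≤ m ∧
    ∀ h : H, MvPolynomial.eval (evalMat (h : GL (Fin n) k)) Q ≠ 0 ∧
      ∀ i j, ((τ h : GL (Fin l) k) : Matrix (Fin l) (Fin l) k) i j =
        MvPolynomial.eval (evalMat (h : GL (Fin n) k)) (P i j) /
          MvPolynomial.eval (evalMat (h : GL (Fin n) k)) Q

theorem pdiv {B : Type*} [CommRing B] (g : Polynomial B) (hg : 0 < g.natDegree) (n : ℕ) :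
    ∀ p : Polynomial B, p.natDegree ≤ n → ∃ (a : ℕ) (q r : Polynomial B),
      Polynomial.C (g.leadingCoeff ^ a) * p = q * g + r ∧ r.natDegree < g.natDegree := by
  induction n with
  | zero =>
    intro p hp
    exact ⟨0, 0, p, by simp, by omega⟩
  | succ n ih =>
    intro p hp
    by_cases h : p.natDegree < g.natDegree
    · exact ⟨0, 0, p, by simp, h⟩
    push Not at h
    set p' := Polynomial.C g.leadingCoeff * p -
      Polynomial.C p.leadingCoeff * Polynomial.X ^ (p.natDegree - g.natDegree) * g with hp'
    have hd : p'.natDegree ≤ n := by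
      rw [Polynomial.natDegree_le_iff_coeff_eq_zero]
      intro N hN
      rw [hp', mul_assoc, Polynomial.coeff_sub, Polynomial.coeff_C_mul, Polynomial.coeff_C_mul,
        Polynomial.coeff_X_pow_mul']
      rw [if_pos (by omega)]
      rcases lt_or_ge p.natDegree N with h1 | h1
      · rw [Polynomial.coeff_eq_zero_of_natDegree_lt h1,
          Polynomial.coeff_eq_zero_of_natDegree_lt (by omega)]
        simp
      · have : N = p.natDegree := by omega
        subst this
        rw [show p.natDegree - (p.natDegree - g.natDegree) = g.natDegree by omega]
        simp only [Polynomial.coeff_natDegree]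
        ring
    obtain ⟨a, q, r, h1, h2⟩ := ih p' hd
    refine ⟨a + 1, q + Polynomial.C (g.leadingCoeff ^ a) * Polynomial.C p.leadingCoeff *
      Polynomial.X ^ (p.natDegree - g.natDegree), r, ?_, h2⟩
    rw [hp'] at h1
    rw [pow_succ, Polynomial.C_mul]
    linear_combination h1

section
set_option linter.unusedSectionVars false
variable {k : Type*} [Field k] {σ : Type*} [LinearOrder σ]

/-- split off the variable `s`. -/
noncomputable def toPh (s : σ) : MvPolynomial σ k →ₐ[k] Polynomial (MvPolynomial σ k) :=
  aeval (fun i => if i = s then Polynomial.X else Polynomial.C (X i))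

theorem toPh_monomial (s : σ) (m : σ →₀ ℕ) (a : k) :
    toPh s (monomial m a) = Polynomial.monomial (m s) (monomial (m.erase s) a) := by
  have h1 : monomial m a = monomial (m.erase s) a * X s ^ (m s) := by
    rw [mul_comm, ← monomial_single_add, Finsupp.single_add_erase]
  have h2 : ∀ m' : σ →₀ ℕ, m' s = 0 → toPh s (monomial m' a) = Polynomial.C (monomial m' a) := by
    intro m' hm'
    rw [toPh, aeval_monomial, monomial_eq, map_mul]
    congr 1
    rw [Finsupp.prod, Finsupp.prod, map_prod]
    refine Finset.prod_congr rfl fun i hi => ?_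
    have : i ≠ s := by
      rintro rfl
      simp [hm'] at hi
    simp [this]
  rw [h1, map_mul, map_pow, h2 _ (by simp)]
  simp [toPh, Polynomial.C_mul_X_pow_eq_monomial]

theorem toPh_supp (s : σ) (a : supported k (Set.Iio s)) :
    toPh s (a : MvPolynomial σ k) = Polynomial.C (a : MvPolynomial σ k) := by
  have h := a.2
  rw [mem_supported] at h
  have : ∀ m ∈ (a : MvPolynomial σ k).support, m s = 0 := by
    intro m hm
    by_contra h0
    have : s ∈ (a : MvPolynomial σ k).vars := by
      rw [mem_vars_iff_mem_support]; exact ⟨m, hm, by simpa using h0⟩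
    exact lt_irrefl _ (h this)
  conv_lhs => rw [← support_sum_monomial_coeff (a : MvPolynomial σ k)]
  conv_rhs => rw [← support_sum_monomial_coeff (a : MvPolynomial σ k)]
  rw [map_sum, map_sum]
  refine Finset.sum_congr rfl fun m hm => ?_
  rw [toPh_monomial, this m hm]
  have : m.erase s = m := by
    rw [Finsupp.erase_of_notMem_support]; simpa using this m hm
  rw [this]; rfl

theorem toPh_aeval (s : σ) (p : Polynomial (supported k (Set.Iio s))) :
    toPh s (Polynomial.aeval (X s : MvPolynomial σ k) p) =
      p.map (algebraMap _ (MvPolynomial σ k)) := by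
  rw [Polynomial.aeval_eq_sum_range, map_sum]
  conv_rhs => rw [p.as_sum_range_C_mul_X_pow, Polynomial.map_sum]
  refine Finset.sum_congr rfl fun i _ => ?_
  rw [Algebra.smul_def, map_mul, map_pow]
  have : toPh s (X s : MvPolynomial σ k) = Polynomial.X := by simp [toPh]
  rw [this]
  have := toPh_supp s (p.coeff i)
  simp only [Polynomial.map_mul, Polynomial.map_C, Polynomial.map_pow, Polynomial.map_X]
  exact congrArg (· * _) this

theorem toPh_coeff (s : σ) (g : MvPolynomial σ k) (j : ℕ) :
    (toPh s g).coeff j = (g.support.filter fun m => m s = j).sum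
      fun m => monomial (m.erase s) (g.coeff m) := by
  conv_lhs => rw [← support_sum_monomial_coeff g]
  rw [map_sum, Polynomial.finsetSum_coeff, Finset.sum_filter]
  refine Finset.sum_congr rfl fun m hm => ?_
  rw [toPh_monomial, Polynomial.coeff_monomial]

theorem degreeOf_aeval (s : σ) (p : Polynomial (supported k (Set.Iio s))) :
    (Polynomial.aeval (X s : MvPolynomial σ k) p).degreeOf s = p.natDegree := by
  classical
  apply le_antisymm
  · rw [Polynomial.aeval_eq_sum_range]
    refine (degreeOf_sum_le s _ _).trans ?_
    refine Finset.sup_le fun i hi => ?_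
    rw [Algebra.smul_def]
    refine (degreeOf_mul_le _ _ _).trans ?_
    have h1 : degreeOf s (algebraMap _ (MvPolynomial σ k) (p.coeff i)) = 0 := by
      rw [← Nat.le_zero, degreeOf_le_iff]
      intro m hm
      by_contra h0
      have h := (p.coeff i).2
      rw [mem_supported] at h
      have : s ∈ ((p.coeff i) : MvPolynomial σ k).vars := by
        rw [mem_vars_iff_mem_support]; exact ⟨m, hm, by simp; omega⟩
      exact lt_irrefl _ (h this)
    rw [h1]
    refine le_trans (add_le_add le_rfl (degreeOf_pow_le _ _ _)) ?_
    rw [degreeOf_X]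
    simp at hi ⊢
    omega
  · by_cases hp : p = 0
    · simp [hp]
    by_contra hlt
    push Not at hlt
    have h1 : (toPh s (Polynomial.aeval (X s : MvPolynomial σ k) p)).coeff p.natDegree = 0 := by
      rw [toPh_coeff]
      rw [Finset.filter_eq_empty_iff.2, Finset.sum_empty]
      intro m hm h
      have := monomial_le_degreeOf s hm
      omega
    rw [toPh_aeval, Polynomial.coeff_map] at h1
    have := (map_eq_zero_iff _ (FaithfulSMul.algebraMap_injective _ _)).1 h1
    exact hp (Polynomial.leadingCoeff_eq_zero.1 this)

theorem leadCoeff_aeval (s : σ) (p : Polynomial (supported k (Set.Iio s))) :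
    leadCoeff s (Polynomial.aeval (X s : MvPolynomial σ k) p) = p.leadingCoeff := by
  rw [leadCoeff, ← toPh_coeff, toPh_aeval, degreeOf_aeval, Polynomial.coeff_map]; rfl

theorem exists_aeval (s : σ) (f : MvPolynomial σ k) (hf : f ∈ supported k (Set.Iic s)) :
    ∃ p : Polynomial (supported k (Set.Iio s)), Polynomial.aeval (X s : MvPolynomial σ k) p = f := by
  rw [← support_sum_monomial_coeff f]
  rw [mem_supported] at hf
  have : ∀ m ∈ f.support, ∃ p : Polynomial (supported k (Set.Iio s)),
      Polynomial.aeval (X s : MvPolynomial σ k) p = monomial m (f.coeff m) := by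
    intro m hm
    refine ⟨Polynomial.monomial (m s) ⟨monomial (m.erase s) (f.coeff m), ?_⟩, ?_⟩
    · rw [mem_supported]
      intro i hi
      have h0 : f.coeff m ≠ 0 := by simpa using hm
      rw [vars_monomial h0, Finsupp.support_erase] at hi
      simp only [Finset.coe_erase, Set.mem_sdiff, Set.mem_singleton_iff] at hi
      have : i ∈ f.vars := by
        rw [mem_vars_iff_mem_support]; exact ⟨m, hm, hi.1⟩
      exact lt_of_le_of_ne (hf this) hi.2
    · rw [Polynomial.aeval_monomial]
      have h1 : monomial m (f.coeff m) = monomial (m.erase s) (f.coeff m) * X s ^ (m s) := by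
        rw [mul_comm, ← monomial_single_add, Finsupp.single_add_erase]
      rw [h1]; rfl
  choose! p hp using this
  refine ⟨∑ m ∈ f.support, p m, ?_⟩
  rw [map_sum]
  exact Finset.sum_congr rfl hp

def FreeAt (P : Ideal (MvPolynomial σ k)) (s : σ) : Prop :=
  ∀ p : Polynomial (supported k (Set.Iio s)), Polynomial.aeval (X s : MvPolynomial σ k) p ∈ P →
    ∀ j, (p.coeff j : MvPolynomial σ k) ∈ P

def AlgAt (P : Ideal (MvPolynomial σ k)) (E : ℕ) (s : σ)
    (g : Polynomial (supported k (Set.Iio s))) : Prop :=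
  0 < g.natDegree ∧ (g.leadingCoeff : MvPolynomial σ k) ∉ P ∧
    Polynomial.aeval (X s : MvPolynomial σ k) g ∈ P ∧
    (Polynomial.aeval (X s : MvPolynomial σ k) g).totalDegree ≤ E ∧
    ∀ p : Polynomial (supported k (Set.Iio s)), p.natDegree < g.natDegree →
      Polynomial.aeval (X s : MvPolynomial σ k) p ∈ P → ∀ j, (p.coeff j : MvPolynomial σ k) ∈ P

theorem vars_max_aeval (s : σ) (g : Polynomial (supported k (Set.Iio s))) (hg : 0 < g.natDegree) :
    (Polynomial.aeval (X s : MvPolynomial σ k) g).vars.max = (s : WithBot σ) := by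
  classical
  have h1 : s ∈ (Polynomial.aeval (X s : MvPolynomial σ k) g).vars := by
    by_contra h
    have h2 : (Polynomial.aeval (X s : MvPolynomial σ k) g).degreeOf s ≤ 0 := by
      rw [degreeOf_le_iff]
      intro m hm
      by_contra h0
      exact h ((mem_vars_iff_mem_support _).2 ⟨m, hm, by simp; omega⟩)
    rw [degreeOf_aeval] at h2
    omega
  apply le_antisymm _ (Finset.le_max h1)
  refine Finset.max_le fun i hi => ?_
  have : Polynomial.aeval (X s : MvPolynomial σ k) g ∈ supported k (Set.Iic s) := by
    rw [Polynomial.aeval_eq_sum_range]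
    refine Subalgebra.sum_mem _ fun j _ => ?_
    rw [Algebra.smul_def]
    refine Subalgebra.mul_mem _ ?_ (Subalgebra.pow_mem _ ?_ _)
    · exact supported_mono (Set.Iio_subset_Iic_self) (g.coeff j).2
    · rw [X_mem_supported]; simp
  rw [mem_supported] at this
  exact WithBot.coe_le_coe.2 (this hi)

def Sat (g : σ → MvPolynomial σ k) (w : σ → MvPolynomial σ k) (T : Set σ) (f : MvPolynomial σ k) :
    Prop := ∃ a ∈ Submonoid.closure (w '' T), a * f ∈ Ideal.span (g '' T)

theorem Sat.add {g w : σ → MvPolynomial σ k} {T : Set σ} {f f' : MvPolynomial σ k}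
    (h : Sat g w T f) (h' : Sat g w T f') : Sat g w T (f + f') := by
  obtain ⟨a, ha, h⟩ := h
  obtain ⟨b, hb, h'⟩ := h'
  refine ⟨a * b, Submonoid.mul_mem _ ha hb, ?_⟩
  have : a * b * (f + f') = b * (a * f) + a * (b * f') := by ring
  rw [this]
  exact Ideal.add_mem _ (Ideal.mul_mem_left _ _ h) (Ideal.mul_mem_left _ _ h')

theorem Sat.mul {g w : σ → MvPolynomial σ k} {T : Set σ} {f : MvPolynomial σ k}
    (h : Sat g w T f) (c : MvPolynomial σ k) : Sat g w T (c * f) := by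
  obtain ⟨a, ha, h⟩ := h
  refine ⟨a, ha, ?_⟩
  rw [mul_left_comm]
  exact Ideal.mul_mem_left _ _ h

theorem Sat.zero {g w : σ → MvPolynomial σ k} {T : Set σ} : Sat g w T 0 :=
  ⟨1, Submonoid.one_mem _, by simp⟩

theorem Sat.aeval {g w : σ → MvPolynomial σ k} {T : Set σ} {s : σ}
    (p : Polynomial (supported k (Set.Iio s)))
    (h : ∀ j, Sat g w T (p.coeff j : MvPolynomial σ k)) :
    Sat g w T (Polynomial.aeval (X s : MvPolynomial σ k) p) := by
  rw [Polynomial.aeval_eq_sum_range]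
  refine Finset.sum_induction _ (Sat g w T) (fun _ _ => Sat.add) Sat.zero fun j _ => ?_
  rw [Algebra.smul_def, mul_comm]
  exact (h j).mul _

theorem sat_of_mem [WellFoundedLT σ] (P : Ideal (MvPolynomial σ k)) [P.IsPrime] (E : ℕ)
    (T : Set σ) (p : ∀ s : σ, Polynomial (supported k (Set.Iio s)))
    (hf : ∀ s, s ∉ T → FreeAt P s) (ha : ∀ s ∈ T, AlgAt P E s (p s)) (s : σ) :
    ∀ f ∈ P, f ∈ supported k (Set.Iic s) →
    Sat (fun s => Polynomial.aeval (X s : MvPolynomial σ k) (p s))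
      (fun s => ((p s).leadingCoeff : MvPolynomial σ k)) T f := by
  induction s using WellFoundedLT.induction with
  | ind s ih =>
  intro f hfP hfs
  have hco : ∀ c : supported k (Set.Iio s), (c : MvPolynomial σ k) ∈ P →
    Sat (fun s => Polynomial.aeval (X s : MvPolynomial σ k) (p s))
      (fun s => ((p s).leadingCoeff : MvPolynomial σ k)) T (c : MvPolynomial σ k) := by
    intro c hc
    have h := c.2
    rw [mem_supported] at h
    by_cases hv : (c : MvPolynomial σ k).vars = ∅
    · have hv' : (c : MvPolynomial σ k) ∈ supported k (∅ : Set σ) := by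
        rw [mem_supported, hv]; simp
      rw [supported_empty, Algebra.mem_bot] at hv'
      obtain ⟨x, hx⟩ := hv'
      rw [algebraMap_eq] at hx
      by_cases hx0 : x = 0
      · rw [← hx, hx0, map_zero]; exact Sat.zero
      · exfalso
        rw [← hx] at hc
        exact ‹P.IsPrime›.ne_top (Ideal.eq_top_of_isUnit_mem _ hc
          ((IsUnit.mk0 x hx0).map (C : k →+* MvPolynomial σ k)))
    · rw [← Ne, ← Finset.nonempty_iff_ne_empty] at hv
      refine ih ((c : MvPolynomial σ k).vars.max' hv) (h (Finset.max'_mem _ _)) _ hc ?_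
      rw [mem_supported]
      intro i hi
      exact Finset.le_max' _ _ hi
  obtain ⟨q, rfl⟩ := exists_aeval s f hfs
  by_cases hs : s ∈ T
  · obtain ⟨h0, hlc, hgP, -, hmin⟩ := ha s hs
    obtain ⟨a, u, r, h1, h2⟩ := pdiv (p s) h0 _ q le_rfl
    have h3 : ((p s).leadingCoeff : MvPolynomial σ k) ^ a *
        Polynomial.aeval (X s : MvPolynomial σ k) q =
        Polynomial.aeval (X s : MvPolynomial σ k) u * Polynomial.aeval (X s : MvPolynomial σ k) (p s)
        + Polynomial.aeval (X s : MvPolynomial σ k) r := by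
      rw [← map_mul, ← map_add, ← h1, map_mul, Polynomial.aeval_C, map_pow]; rfl
    have hr : Polynomial.aeval (X s : MvPolynomial σ k) r ∈ P := by
      rw [← sub_eq_iff_eq_add'] at h3
      rw [← h3]
      exact P.sub_mem (P.mul_mem_left _ hfP) (P.mul_mem_left _ hgP)
    obtain ⟨b, hb, hbr⟩ := Sat.aeval r fun j => hco _ (hmin r h2 hr j)
    refine ⟨b * ((p s).leadingCoeff : MvPolynomial σ k) ^ a, Submonoid.mul_mem _ hb
      (Submonoid.pow_mem _ (Submonoid.subset_closure (Set.mem_image_of_mem _ hs)) _), ?_⟩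
    rw [mul_assoc, h3, mul_add, ← mul_assoc]
    exact Ideal.add_mem _ (Ideal.mul_mem_left _ _ (Ideal.subset_span ⟨s, hs, rfl⟩)) hbr
  · exact Sat.aeval q fun j => hco _ (hf s hs q hfP j)

theorem lemC6 [Fintype σ] (P : Ideal (MvPolynomial σ k)) [hP : P.IsPrime] (E : ℕ)
    (h : ∀ s, FreeAt P s ∨ ∃ g, AlgAt P E s g) :
    ∃ G : List (MvPolynomial σ k), IsTriangularSet G ∧ (P : Set (MvPolynomial σ k)) = trep G ∧
      ∀ g ∈ G, g.totalDegree ≤ E := by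
  classical
  have h' : ∀ s, ∃ g, ¬ FreeAt P s → AlgAt P E s g := by
    intro s
    rcases h s with h | ⟨g, h⟩
    · exact ⟨0, fun h' => absurd h h'⟩
    · exact ⟨g, fun _ => h⟩
  choose p hp using h'
  set T : Finset σ := Finset.univ.filter fun s => ¬ FreeAt P s with hT
  have ha : ∀ s ∈ (T : Set σ), AlgAt P E s (p s) := fun s hs => hp s (by simpa [hT] using hs)
  have hf : ∀ s, s ∉ (T : Set σ) → FreeAt P s := fun s hs => by simpa [hT] using hs
  set g : σ → MvPolynomial σ k := fun s => Polynomial.aeval (X s : MvPolynomial σ k) (p s) with hg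
  set l := T.sort (· ≤ ·) with hl
  have hlT : ∀ s, s ∈ l ↔ s ∈ T := by simp [hl]
  have hmem : ∀ x ∈ l.map g, ∃ s ∈ T, g s = x := by
    intro x hx
    obtain ⟨s, hs, rfl⟩ := List.mem_map.1 hx
    exact ⟨s, (hlT s).1 hs, rfl⟩
  have hmax : ∀ s ∈ T, (g s).vars.max = (s : WithBot σ) := fun s hs =>
    vars_max_aeval s (p s) (ha s hs).1
  have hlen : (l.map g).length = l.length := List.length_map g
  have hget : ∀ i : Fin (l.map g).length, (l.map g).get i = g (l.get (i.cast hlen)) := by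
    intro i; simp
  have hlg : ∀ i : Fin l.length, l.get i ∈ T := fun i => (hlT _).1 (List.get_mem l i)
  have hlc : ∀ s, leadCoeff s (g s) = ((p s).leadingCoeff : MvPolynomial σ k) := fun s =>
    leadCoeff_aeval s (p s)
  refine ⟨l.map g, ⟨?_, ?_⟩, ?_, ?_⟩
  · intro x hx
    obtain ⟨s, hs, rfl⟩ := hmem x hx
    by_contra hne
    rw [Finset.not_nonempty_iff_eq_empty] at hne
    have := hmax s hs
    rw [hne] at this
    simp at this
  · have hs : l.Pairwise (· < ·) := (Finset.sortedLT_sort T).pairwise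
    refine List.Pairwise.isChain ?_
    rw [List.pairwise_map]
    refine hs.imp_of_mem fun {a b} ha' hb' hab => ?_
    rw [hmax a ((hlT a).1 ha'), hmax b ((hlT b).1 hb')]
    exact WithBot.coe_lt_coe.2 hab
  · apply Set.Subset.antisymm
    · intro f hfP
      have hsat : Sat g (fun s => ((p s).leadingCoeff : MvPolynomial σ k)) T f := by
        by_cases hne : Nonempty σ
        · refine sat_of_mem P E T p hf ha (Finset.univ.max' Finset.univ_nonempty) f hfP ?_
          rw [mem_supported]
          intro i _
          exact Finset.le_max' _ _ (Finset.mem_univ _)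
        · rw [not_nonempty_iff] at hne
          have hv' : f ∈ supported k (∅ : Set σ) := by
            rw [mem_supported]; intro i; exact hne.elim i
          rw [supported_empty, Algebra.mem_bot] at hv'
          obtain ⟨x, hx⟩ := hv'
          rw [algebraMap_eq] at hx
          by_cases hx0 : x = 0
          · rw [← hx, hx0, map_zero]; exact Sat.zero
          · exfalso
            rw [← hx] at hfP
            exact hP.ne_top (Ideal.eq_top_of_isUnit_mem _ hfP
              ((IsUnit.mk0 x hx0).map (C : k →+* MvPolynomial σ k)))
      obtain ⟨a, ha1, ha2⟩ := hsat
      set c : Fin (l.map g).length → σ := fun i => l.get (i.cast hlen) with hc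
      have hrange : ∀ w : σ → MvPolynomial σ k, w '' (T : Set σ) = Set.range fun i => w (c i) := by
        intro w
        ext x
        constructor
        · rintro ⟨s, hs, rfl⟩
          obtain ⟨i, hi⟩ := List.get_of_mem ((hlT s).2 hs)
          exact ⟨i.cast hlen.symm, by simp only [hc]; rw [← hi]; rfl⟩
        · rintro ⟨i, rfl⟩
          exact ⟨_, hlg _, rfl⟩
      rw [hrange] at ha1 ha2
      obtain ⟨α, rfl⟩ := Submonoid.mem_closure_range_iff_of_fintype.1 ha1
      obtain ⟨q, hq⟩ := (Submodule.mem_span_range_iff_exists_fun _).1 ha2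
      refine ⟨c, α, q, fun i => ?_, ?_, fun i => ?_⟩
      · rw [hget]; exact hmax _ (hlg _)
      · rw [add_zero]
        simp only [hget, smul_eq_mul] at hq ⊢
        rw [hq]
        congr 1
        refine Finset.prod_congr rfl fun i _ => ?_
        rw [← hlc]
      · rw [hget, degreeOf_zero]
        simp only [hg, hc]
        rw [degreeOf_aeval]
        exact (ha _ (hlg _)).1
    · rintro f ⟨c, α, q, h1, h2, h3⟩
      rw [add_zero] at h2
      have hcs : ∀ i, c i = l.get (i.cast hlen) := by
        intro i
        have := h1 i
        rw [hget, hmax _ (hlg _)] at this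
        exact (WithBot.coe_injective this).symm
      have hmemP : (∏ i, leadCoeff (c i) ((l.map g).get i) ^ α i) * f ∈ P := by
        rw [h2]
        refine Ideal.sum_mem _ fun i _ => P.mul_mem_left _ ?_
        rw [hget]
        exact (ha _ (hlg _)).2.2.1
      rcases hP.mem_or_mem hmemP with h | h
      · exfalso
        obtain ⟨i, -, hi⟩ := hP.prod_mem_iff.1 h
        have := hP.mem_of_pow_mem _ hi
        rw [hget, hcs, hlc] at this
        exact (ha _ (hlg _)).2.1 this
      · exact h
  · intro x hx
    obtain ⟨s, hs, rfl⟩ := hmem x hx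
    exact (ha s hs).2.2.2.1
end

theorem exists_notMem_mul {R : Type*} [CommRing R] [IsNoetherianRing R] (I : Ideal R)
    (hI : I.IsRadical) (P : Ideal R) (hP : P ∈ I.minimalPrimes) :
    ∃ b, b ∉ P ∧ ∀ p ∈ P, b * p ∈ I := by
  classical
  have hfin := I.finite_minimalPrimes_of_isNoetherianRing R
  have hPp : P.IsPrime := hP.1.1
  have : ∀ Q ∈ I.minimalPrimes, ∃ b, Q ≠ P → (b ∈ Q ∧ b ∉ P) := by
    intro Q hQ
    by_cases h : Q = P
    · exact ⟨0, fun h' => absurd h h'⟩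
    · have : ¬ Q ≤ P := fun hle => h (le_antisymm hle (hP.2 hQ.1 hle))
      obtain ⟨b, hb, hb'⟩ := Set.not_subset.1 this
      exact ⟨b, fun _ => ⟨hb, hb'⟩⟩
  choose! b hb using this
  refine ⟨∏ Q ∈ hfin.toFinset.erase P, b Q, ?_, ?_⟩
  · intro h
    obtain ⟨Q, hQ, h⟩ := hPp.prod_mem_iff.1 h
    simp at hQ
    exact (hb Q hQ.2 hQ.1).2 h
  · intro p hp
    have hII : I = sInf I.minimalPrimes := by rw [Ideal.sInf_minimalPrimes, hI.radical]
    refine hII.ge (Ideal.mem_sInf.2 ?_)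
    intro Q hQ
    by_cases h : Q = P
    · rw [h]; exact P.mul_mem_left _ hp
    · refine Q.mul_mem_right _ ?_
      exact Q.mem_of_dvd (Finset.dvd_prod_of_mem b (by simp [h, hQ])) (hb Q hQ h).1

section
set_option linter.unusedSectionVars false
variable {k : Type*} [Field k] {σ : Type*} [LinearOrder σ]

theorem mem_trep_iff {G : List (MvPolynomial σ k)} (c : Fin G.length → σ)
    (hc : ∀ i, (G.get i).vars.max = (c i : WithBot σ)) (f : MvPolynomial σ k) :
    f ∈ trep G ↔ ∃ (α : Fin G.length → ℕ) (q : Fin G.length → MvPolynomial σ k),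
      (∏ i, leadCoeff (c i) (G.get i) ^ α i) * f = ∑ i, q i * G.get i := by
  constructor
  · rintro ⟨c', α, q, h1, h2, -⟩
    have : c' = c := by
      funext i
      exact WithBot.coe_injective ((h1 i).symm.trans (hc i))
    subst this
    exact ⟨α, q, by simpa using h2⟩
  · rintro ⟨α, q, h⟩
    refine ⟨c, α, q, hc, by simpa using h, fun i => ?_⟩
    rw [degreeOf_zero]
    by_contra h0
    have h1 : c i ∈ (G.get i).vars := Finset.mem_of_max (hc i)
    obtain ⟨m, hm, hi⟩ := (mem_vars_iff_mem_support _).1 h1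
    have := monomial_le_degreeOf (c i) hm
    simp only [Finsupp.mem_support_iff] at hi
    omega

theorem exists_eval_ne_zero [Finite σ] [IsAlgClosed k] (P : Ideal (MvPolynomial σ k)) [P.IsPrime]
    (w : MvPolynomial σ k) (hw : w ∉ P) :
    ∃ v : σ → k, (∀ p ∈ P, eval v p = 0) ∧ eval v w ≠ 0 := by
  by_contra! h
  apply hw
  rw [← IsPrime.vanishingIdeal_zeroLocus (K := k) P]
  intro v hv
  exact h v hv
end

section
variable {k : Type*} [Field k]

noncomputable def detP (n : ℕ) (k : Type*) [Field k] : MvPolynomial (Fin n ×ₗ Fin n) k :=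
  Matrix.det (Matrix.of fun i j => X (toLex (i, j)))

theorem eval_detP {n : ℕ} (v : (Fin n ×ₗ Fin n) → k) :
    eval v (detP n k) = Matrix.det (Matrix.of fun i j => v (toLex (i, j))) := by
  rw [detP, RingHom.map_det]
  congr 1
  ext i j
  simp

theorem eval_detP_ne {n : ℕ} (g : GL (Fin n) k) : eval (evalMat g) (detP n k) ≠ 0 := by
  rw [eval_detP]
  have : (Matrix.of fun i j => evalMat g (toLex (i, j))) = (g : Matrix (Fin n) (Fin n) k) := by
    ext i j; rfl
  rw [this]
  exact ((Matrix.isUnit_iff_isUnit_det _).1 g.isUnit).ne_zero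

theorem exists_evalMat {n : ℕ} (v : (Fin n ×ₗ Fin n) → k) (hv : eval v (detP n k) ≠ 0) :
    ∃ g : GL (Fin n) k, evalMat g = v := by
  rw [eval_detP] at hv
  exact ⟨Matrix.GeneralLinearGroup.mkOfDetNeZero _ hv, by funext p; rfl⟩

theorem lemA [IsAlgClosed k] {n : ℕ} (T : Subgroup (GL (Fin n) k)) (D : ℕ)
    (h : SubgroupTriRepBoundedBy T (D : ℝ)) :
    ∃ t₀ ∈ T, ∃ F : Finset (MvPolynomial (Fin n ×ₗ Fin n) k), (∀ f ∈ F, f.totalDegree ≤ D) ∧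
      ∃ u, eval (evalMat t₀) u ≠ 0 ∧ ∀ x : GL (Fin n) k, eval (evalMat x) u ≠ 0 →
        (x ∈ T ↔ ∀ f ∈ F, eval (evalMat x) f = 0) := by
  classical
  obtain ⟨S, hS, N, G, hG, hdeg, hJ, hI⟩ := h
  choose J hJr hJG using hJ
  set I := Ideal.span (S : Set (MvPolynomial (Fin n ×ₗ Fin n) k)) with hIdef
  have hIJ : I.radical = ⨅ i, J i := by
    apply SetLike.coe_injective
    rw [hI, Submodule.coe_iInf]
    simp [hJG]
  have hvan : ∀ x ∈ T, ∀ p ∈ I.radical, eval (evalMat x) p = 0 := by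
    intro x hx p hp
    obtain ⟨m, hm⟩ := hp
    have : I ≤ RingHom.ker (eval (evalMat x)) := by
      rw [hIdef, Ideal.span_le]
      intro q hq
      exact (hS x).1 hx q hq
    have := this hm
    rw [RingHom.mem_ker, map_pow] at this
    exact eq_zero_of_pow_eq_zero this
  have hdet : detP n k ∉ I.radical := fun h => eval_detP_ne (1 : GL (Fin n) k) (hvan 1 T.one_mem _ h)
  rw [← Ideal.sInf_minimalPrimes, Ideal.mem_sInf] at hdet
  push Not at hdet
  obtain ⟨P, hPI, hdP⟩ := hdet
  have hPp : P.IsPrime := hPI.1.1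
  have hIP : I.radical ≤ P := hPp.radical_le_iff.2 hPI.1.2
  obtain ⟨i, hi⟩ : ∃ i, J i ≤ P := by
    have : Finset.univ.inf J ≤ P := by
      rw [Finset.inf_univ_eq_iInf, ← hIJ]; exact hIP
    obtain ⟨i, -, hi⟩ := hPp.inf_le'.1 this
    exact ⟨i, hi⟩
  have hPJ : P ∈ (J i).minimalPrimes := by
    refine ⟨⟨hPp, hi⟩, fun Q hQ hQP => ?_⟩
    refine hPI.2 ⟨hQ.1, ?_⟩ hQP
    refine le_trans Ideal.le_radical (le_trans ?_ hQ.2)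
    rw [hIJ]; exact iInf_le _ _
  set c : Fin (G i).length → (Fin n ×ₗ Fin n) := fun j =>
    ((G i).get j).vars.max' ((hG i).1 _ (List.get_mem _ _)) with hc
  have hcm : ∀ j, ((G i).get j).vars.max = (c j : WithBot _) := fun j =>
    (Finset.coe_max' _).symm
  have hmem : ∀ f, f ∈ J i ↔ _ := fun f => by
    rw [← SetLike.mem_coe, hJG, mem_trep_iff c hcm]
  have hg : ∀ j, (G i).get j ∈ J i := by
    intro j
    rw [hmem]
    refine ⟨0, Pi.single j 1, ?_⟩
    rw [Finset.sum_eq_single j]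
    · simp
    · intro b _ hb; simp [Pi.single_eq_of_ne hb]
    · simp
  have hinit : ∀ j, leadCoeff (c j) ((G i).get j) ∉ P := by
    intro j hj
    obtain ⟨b, hb, hbP⟩ := exists_notMem_mul (J i) (hJr i) P hPJ
    have h1 := hbP _ hj
    apply hb
    apply hi
    rw [hmem] at h1 ⊢
    obtain ⟨α, q, h1⟩ := h1
    refine ⟨α + Pi.single j 1, q, ?_⟩
    rw [← h1]
    simp only [Pi.add_apply, pow_add, Finset.prod_mul_distrib]
    have : ∏ x, leadCoeff (c x) ((G i).get x) ^ (Pi.single j 1 : Fin (G i).length → ℕ) x =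
        leadCoeff (c j) ((G i).get j) := by
      rw [Finset.prod_eq_single j]
      · simp
      · intro b _ hb; simp [Pi.single_eq_of_ne hb]
      · simp
    rw [this]
    ring
  obtain ⟨b, hb, hbP⟩ := exists_notMem_mul I.radical I.radical_isRadical P
    (by rw [Ideal.radical_minimalPrimes]; exact hPI)
  set w := ∏ j, leadCoeff (c j) ((G i).get j) with hw
  have hwP : w ∉ P := by
    intro h
    obtain ⟨j, -, h⟩ := hPp.prod_mem_iff.1 h
    exact hinit j h
  obtain ⟨v, hv1, hv2⟩ := exists_eval_ne_zero P (detP n k * (b * w))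
    (hPp.mul_notMem hdP (hPp.mul_notMem hb hwP))
  rw [map_mul] at hv2
  obtain ⟨t₀, rfl⟩ := exists_evalMat v (left_ne_zero_of_mul hv2)
  refine ⟨t₀, ?_, (G i).toFinset, ?_, b * w, right_ne_zero_of_mul hv2, ?_⟩
  · rw [hS]
    intro p hp
    exact hv1 p (hIP (Ideal.le_radical (Ideal.subset_span hp)))
  · intro f hf
    exact_mod_cast hdeg i f (by simpa using hf)
  · intro x hx
    rw [map_mul] at hx
    constructor
    · intro hxT f hf
      obtain ⟨j, rfl⟩ := List.get_of_mem (List.mem_toFinset.1 hf)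
      have := hvan x hxT _ (hbP _ (hi (hg j)))
      rw [map_mul] at this
      exact (mul_eq_zero.1 this).resolve_left (left_ne_zero_of_mul hx)
    · intro hF
      rw [hS]
      intro p hp
      have hpJ : p ∈ J i := by
        have : p ∈ I.radical := Ideal.le_radical (Ideal.subset_span hp)
        rw [hIJ] at this
        exact (iInf_le J i) this
      rw [hmem] at hpJ
      obtain ⟨α, q, h1⟩ := hpJ
      have h2 := congrArg (eval (evalMat x)) h1
      rw [map_mul, map_sum, Finset.sum_eq_zero, map_prod] at h2
      · refine (mul_eq_zero.1 h2).resolve_left ?_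
        refine Finset.prod_ne_zero_iff.2 ?_
        intro j _
        rw [map_pow]
        have := right_ne_zero_of_mul hx
        rw [hw, map_prod, Finset.prod_ne_zero_iff] at this
        exact pow_ne_zero _ (this j (Finset.mem_univ _))
      · intro j _
        rw [map_mul, hF _ (List.mem_toFinset.2 (List.get_mem _ _)), mul_zero]
end

section
set_option linter.unusedSectionVars false
variable {k : Type*} [Field k]

theorem homSub {ρ σ : Type*} [Finite ρ] (f : MvPolynomial ρ k) (e : ℕ) (he : f.totalDegree ≤ e)
    (A : ρ → MvPolynomial σ k) (Q : MvPolynomial σ k) (m : ℕ)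
    (hA : ∀ p, (A p).totalDegree ≤ m) (hQ : Q.totalDegree ≤ m) :
    ∃ h : MvPolynomial σ k, h.totalDegree ≤ m * e ∧ ∀ v : σ → k, eval v Q ≠ 0 →
      eval v h = eval v Q ^ e * eval (fun p => eval v (A p) / eval v Q) f := by
  have := Fintype.ofFinite ρ
  have hβ : ∀ β ∈ f.support, ∑ p, β p ≤ e := by
    intro β hβ
    have := le_totalDegree hβ
    rw [Finsupp.sum_fintype _ _ (by simp)] at this
    exact this.trans he
  refine ⟨∑ β ∈ f.support, C (f.coeff β) * ((∏ p, A p ^ β p) * Q ^ (e - ∑ p, β p)), ?_, ?_⟩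
  · refine totalDegree_finsetSum_le fun β hb => ?_
    refine (totalDegree_mul _ _).trans ?_
    rw [totalDegree_C, zero_add]
    refine (totalDegree_mul _ _).trans ?_
    have h1 : (∏ p, A p ^ β p).totalDegree ≤ m * ∑ p, β p := by
      refine (totalDegree_finsetProd _ _).trans ?_
      rw [Finset.mul_sum]
      refine Finset.sum_le_sum fun p _ => ?_
      refine (totalDegree_pow _ _).trans ?_
      rw [mul_comm]
      exact Nat.mul_le_mul_right _ (hA p)
    have h2 : (Q ^ (e - ∑ p, β p)).totalDegree ≤ m * (e - ∑ p, β p) := by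
      refine (totalDegree_pow _ _).trans ?_
      rw [mul_comm]
      exact Nat.mul_le_mul_right _ hQ
    calc _ ≤ m * ∑ p, β p + m * (e - ∑ p, β p) := add_le_add h1 h2
      _ = m * e := by rw [← mul_add, Nat.add_sub_cancel' (hβ β hb)]
  · intro v hv
    rw [map_sum, eval_eq' _ f, Finset.mul_sum]
    refine Finset.sum_congr rfl fun β hb => ?_
    simp only [map_mul, eval_C, map_prod, map_pow, div_pow, Finset.prod_div_distrib]
    rw [Finset.prod_pow_eq_pow_sum]
    have : eval v Q ^ e = eval v Q ^ (∑ p, β p) * eval v Q ^ (e - ∑ p, β p) := by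
      rw [← pow_add, Nat.add_sub_cancel' (hβ β hb)]
    rw [this]
    field_simp

theorem evalMat_mul {n : ℕ} (x g : GL (Fin n) k) (p : Fin n ×ₗ Fin n) :
    evalMat (x * g) p = ∑ j, evalMat x (toLex ((ofLex p).1, j)) *
      (g : Matrix (Fin n) (Fin n) k) j (ofLex p).2 := by
  simp [evalMat, Matrix.mul_apply]

theorem transl {n : ℕ} (f : MvPolynomial (Fin n ×ₗ Fin n) k) (e : ℕ) (he : f.totalDegree ≤ e)
    (g : GL (Fin n) k) : ∃ h : MvPolynomial (Fin n ×ₗ Fin n) k, h.totalDegree ≤ e ∧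
      ∀ x : GL (Fin n) k, eval (evalMat x) h = eval (evalMat (x * g)) f := by
  have : Finite (Fin n ×ₗ Fin n) := inferInstanceAs (Finite (Fin n × Fin n))
  obtain ⟨h, h1, h2⟩ := homSub f e he (fun p => ∑ j, X (toLex ((ofLex p).1, j)) *
    C ((g : Matrix (Fin n) (Fin n) k) j (ofLex p).2)) (1 : MvPolynomial (Fin n ×ₗ Fin n) k) 1
    (fun p => by
      refine totalDegree_finsetSum_le fun j _ => ?_
      refine (totalDegree_mul _ _).trans ?_
      simp) (by simp)
  refine ⟨h, by simpa using h1, fun x => ?_⟩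
  rw [h2 _ (by simp)]
  simp only [map_one, one_pow, one_mul, div_one]
  congr 2
  funext p
  rw [evalMat_mul]
  simp

theorem lemB [IsAlgClosed k] {n l : ℕ}
    (H : Subgroup (GL (Fin n) k)) (H' : Subgroup (GL (Fin l) k))
    (d d' m : ℕ)
    (hH : SubgroupTriRepBoundedBy H (d : ℝ))
    (hH' : SubgroupTriRepBoundedBy H' (d' : ℝ))
    (τ : H →* GL (Fin l) k) (hτ : HomBoundedBy τ m) (κ : GL (Fin n) k)
    (hκ : κ ∈ Subgroup.map H.subtype (Subgroup.comap τ H')) :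
    ∃ F : Finset (MvPolynomial (Fin n ×ₗ Fin n) k), (∀ f ∈ F, f.totalDegree ≤ max d (m * d')) ∧
      ∃ u, eval (evalMat κ) u ≠ 0 ∧ ∀ x : GL (Fin n) k, eval (evalMat x) u ≠ 0 →
        (x ∈ Subgroup.map H.subtype (Subgroup.comap τ H') ↔ ∀ f ∈ F, eval (evalMat x) f = 0) := by
  classical
  have : Finite (Fin l ×ₗ Fin l) := inferInstanceAs (Finite (Fin l × Fin l))
  obtain ⟨t, ht, F₁, hF₁, u₁, hu₁, hA₁⟩ := lemA H d hH
  obtain ⟨t', ht', F₂, hF₂, u₂, hu₂, hA₂⟩ := lemA H' d' hH'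
  obtain ⟨P, Q, hP, hQ, hPQ⟩ := hτ
  choose P' hP' hP'e using fun i j => transl (P i j) m (hP i j) κ⁻¹
  obtain ⟨Q', hQ', hQ'e⟩ := transl Q m hQ κ⁻¹
  have htr : ∀ f : MvPolynomial (Fin n ×ₗ Fin n) k, ∃ h : MvPolynomial (Fin n ×ₗ Fin n) k,
    h.totalDegree ≤ f.totalDegree ∧
      ∀ x : GL (Fin n) k, eval (evalMat x) h = eval (evalMat (x * κ⁻¹ * t)) f := by
    intro f
    obtain ⟨h, h1, h2⟩ := transl f _ le_rfl (κ⁻¹ * t)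
    exact ⟨h, h1, fun x => by rw [h2, mul_assoc]⟩
  choose tr htr1 htr2 using htr
  set A : (Fin l ×ₗ Fin l) → MvPolynomial (Fin n ×ₗ Fin n) k := fun p =>
    ∑ j, P' (ofLex p).1 j * C ((t' : Matrix (Fin l) (Fin l) k) j (ofLex p).2) with hA
  have hAd : ∀ p, (A p).totalDegree ≤ m := by
    intro p
    refine totalDegree_finsetSum_le fun j _ => ?_
    refine (totalDegree_mul _ _).trans ?_
    simpa using hP' _ _
  have hhom : ∀ (e : ℕ) (f : MvPolynomial (Fin l ×ₗ Fin l) k), ∃ h : MvPolynomial (Fin n ×ₗ Fin n) k,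
      f.totalDegree ≤ e → (h.totalDegree ≤ m * e ∧
      ∀ (x : GL (Fin n) k) (hx : x * κ⁻¹ ∈ H), eval (evalMat x) h =
        eval (evalMat x) Q' ^ e * eval (evalMat (τ ⟨_, hx⟩ * t')) f) := by
    intro e f
    by_cases hf : f.totalDegree ≤ e
    · obtain ⟨h, h1, h2⟩ := homSub f e hf A Q' m hAd hQ'
      refine ⟨h, fun _ => ⟨h1, fun x hx => ?_⟩⟩
      have hq := hPQ ⟨_, hx⟩
      rw [h2 _ (by rw [hQ'e]; exact hq.1)]
      congr 3
      funext p
      rw [evalMat_mul, hA]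
      simp only [map_sum, map_mul, eval_C, Finset.sum_div]
      refine Finset.sum_congr rfl fun j _ => ?_
      have := hq.2 (ofLex p).1 j
      simp only [evalMat, ofLex_toLex]
      rw [this, mul_div_right_comm]
      congr 2
      · exact hP'e _ _ x
      · exact hQ'e x
    · exact ⟨0, fun h => absurd h hf⟩
  choose hom hhom using hhom
  have hmemK : ∀ y, y ∈ Subgroup.map H.subtype (Subgroup.comap τ H') ↔ ∃ hy : y ∈ H, τ ⟨y, hy⟩ ∈ H' := by
    intro y
    rw [Subgroup.mem_map]
    constructor
    · rintro ⟨⟨z, hz⟩, h1, rfl⟩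
      exact ⟨hz, h1⟩
    · rintro ⟨hy, h⟩
      exact ⟨⟨y, hy⟩, h, rfl⟩
  have h1 : κ * κ⁻¹ ∈ H := by rw [mul_inv_cancel]; exact H.one_mem
  refine ⟨F₁.image tr ∪ F₂.image (hom d'), ?_, tr u₁ * Q' * hom u₂.totalDegree u₂, ?_, ?_⟩
  · intro f hf
    rcases Finset.mem_union.1 hf with hf | hf
    · obtain ⟨g, hg, rfl⟩ := Finset.mem_image.1 hf
      exact (htr1 g).trans ((hF₁ g hg).trans (le_max_left _ _))
    · obtain ⟨g, hg, rfl⟩ := Finset.mem_image.1 hf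
      exact (hhom d' g (hF₂ g hg)).1.trans (le_max_right _ _)
  · have hq : eval (evalMat κ) Q' ≠ 0 := by
      rw [hQ'e]; exact (hPQ ⟨_, h1⟩).1
    rw [map_mul, map_mul]
    refine mul_ne_zero (mul_ne_zero ?_ hq) ?_
    · rw [htr2, mul_inv_cancel, one_mul]; exact hu₁
    · rw [(hhom _ u₂ le_rfl).2 κ h1]
      refine mul_ne_zero (pow_ne_zero _ hq) ?_
      have : (⟨κ * κ⁻¹, h1⟩ : H) = 1 := by ext1; simp
      rw [this, map_one, one_mul]
      exact hu₂
  · intro x hx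
    rw [map_mul, map_mul] at hx
    have hx1 := left_ne_zero_of_mul (left_ne_zero_of_mul hx)
    have hx2 := right_ne_zero_of_mul (left_ne_zero_of_mul hx)
    have hx3 := right_ne_zero_of_mul hx
    have e1 : x ∈ Subgroup.map H.subtype (Subgroup.comap τ H') ↔
        x * κ⁻¹ ∈ Subgroup.map H.subtype (Subgroup.comap τ H') :=
      (Subgroup.mul_mem_cancel_right _ (Subgroup.inv_mem _ hκ)).symm
    rw [e1, hmemK]
    have e2 : x * κ⁻¹ ∈ H ↔ ∀ f ∈ F₁, eval (evalMat x) (tr f) = 0 := by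
      rw [← Subgroup.mul_mem_cancel_right H ht, hA₁ _ (by rw [← htr2]; exact hx1)]
      simp only [htr2]
    have e3 : ∀ hy : x * κ⁻¹ ∈ H, τ ⟨x * κ⁻¹, hy⟩ ∈ H' ↔
        ∀ f ∈ F₂, eval (evalMat x) (hom d' f) = 0 := by
      intro hy
      rw [(hhom _ u₂ le_rfl).2 x hy] at hx3
      rw [← Subgroup.mul_mem_cancel_right H' ht', hA₂ _ (right_ne_zero_of_mul hx3)]
      refine forall₂_congr fun f hf => ?_
      rw [(hhom d' f (hF₂ f hf)).2 x hy, mul_eq_zero, or_iff_right (pow_ne_zero _ hx2)]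
    constructor
    · rintro ⟨hy, h⟩ f hf
      rcases Finset.mem_union.1 hf with hf | hf
      · obtain ⟨g, hg, rfl⟩ := Finset.mem_image.1 hf
        exact e2.1 hy g hg
      · obtain ⟨g, hg, rfl⟩ := Finset.mem_image.1 hf
        exact (e3 hy).1 h g hg
    · intro h
      have hy := e2.2 fun f hf => h _ (Finset.mem_union_left _ (Finset.mem_image_of_mem _ hf))
      exact ⟨hy, (e3 hy).2 fun f hf => h _ (Finset.mem_union_right _ (Finset.mem_image_of_mem _ hf))⟩

theorem closedK {n l : ℕ}
    (H : Subgroup (GL (Fin n) k)) (H' : Subgroup (GL (Fin l) k))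
    (d d' m : ℕ)
    (hH : SubgroupTriRepBoundedBy H (d : ℝ))
    (hH' : SubgroupTriRepBoundedBy H' (d' : ℝ))
    (τ : H →* GL (Fin l) k) (hτ : HomBoundedBy τ m) (x : GL (Fin n) k)
    (hx : ∀ p : MvPolynomial (Fin n ×ₗ Fin n) k,
      (∀ y ∈ Subgroup.map H.subtype (Subgroup.comap τ H'), eval (evalMat y) p = 0) →
      eval (evalMat x) p = 0) :
    x ∈ Subgroup.map H.subtype (Subgroup.comap τ H') := by
  have : Finite (Fin l ×ₗ Fin l) := inferInstanceAs (Finite (Fin l × Fin l))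
  obtain ⟨S, hS, -⟩ := hH
  obtain ⟨S', hS', -⟩ := hH'
  obtain ⟨P, Q, hP, hQ, hPQ⟩ := hτ
  have hxH : x ∈ H := by
    rw [hS]
    intro p hp
    refine hx p ?_
    rintro y ⟨z, -, rfl⟩
    exact (hS _).1 z.2 p hp
  refine ⟨⟨x, hxH⟩, ?_, rfl⟩
  change τ ⟨x, hxH⟩ ∈ H'
  rw [hS']
  intro f hf
  obtain ⟨h, -, h2⟩ := homSub f _ le_rfl (fun p => P (ofLex p).1 (ofLex p).2) Q m
    (fun p => hP _ _) hQ
  have h3 : ∀ z : H, eval (evalMat (z : GL (Fin n) k)) h =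
      eval (evalMat (z : GL (Fin n) k)) Q ^ f.totalDegree * eval (evalMat (τ z)) f := by
    intro z
    rw [h2 _ (hPQ z).1]
    congr 3
    funext p
    exact ((hPQ z).2 _ _).symm
  have h4 : eval (evalMat x) h = 0 := by
    refine hx h ?_
    rintro y ⟨z, hz, rfl⟩
    have := h3 z
    rw [(hS' _).1 hz f hf, mul_zero] at this
    exact this
  have h5 := h3 ⟨x, hxH⟩
  rw [h4] at h5
  exact (mul_eq_zero.1 h5.symm).resolve_left (pow_ne_zero _ (hPQ ⟨x, hxH⟩).1)

def EB (N M : ℕ) : ℕ := if M ≤ 1 then M else (N + 2) ^ (N + 2) * M ^ (N + 1)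

theorem EB_bound (n M : ℕ) (hn : 1 < n) :
    (EB (n * n) M : ℝ) ≤ (n : ℝ) * (M : ℝ) ^ (5.5 * (n : ℝ) ^ 3) := by
  have hn0 : (0 : ℝ) < n := by positivity
  rw [EB]
  split_ifs with h
  · rcases Nat.le_one_iff_eq_zero_or_eq_one.1 h with rfl | rfl
    · rw [Nat.cast_zero, Real.zero_rpow (by positivity), mul_zero]
    · rw [Nat.cast_one, Real.one_rpow, mul_one]
      exact_mod_cast hn.le
  · push Not at h
    have h1 : n * n + 2 ≤ 2 ^ (2 * n) := by
      have : ∀ j, (j + 2) * (j + 2) + 2 ≤ 2 ^ (2 * (j + 2)) := by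
        intro j
        induction j with
        | zero => norm_num
        | succ j ih =>
          rw [show 2 * (j + 1 + 2) = 2 * (j + 2) + 2 by ring, pow_add]
          nlinarith
      obtain ⟨j, rfl⟩ := Nat.exists_eq_add_of_le' hn
      exact this j
    have h2 : (n * n + 2) ^ (n * n + 2) * M ^ (n * n + 1) ≤ M ^ (5 * n ^ 3) := by
      calc _ ≤ (M ^ (2 * n)) ^ (n * n + 2) * M ^ (n * n + 1) := by
            gcongr
            exact h1.trans (Nat.pow_le_pow_left h _)
        _ = M ^ (2 * n * (n * n + 2) + (n * n + 1)) := by rw [← pow_mul, ← pow_add]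
        _ ≤ _ := by
          apply Nat.pow_le_pow_right (by omega)
          obtain ⟨j, rfl⟩ := Nat.exists_eq_add_of_le' hn
          ring_nf
          nlinarith [Nat.zero_le j, Nat.zero_le (j ^ 2), Nat.zero_le (j ^ 3)]
    have hM : (1 : ℝ) ≤ M := by exact_mod_cast h.le
    calc (((n * n + 2) ^ (n * n + 2) * M ^ (n * n + 1) : ℕ) : ℝ) ≤ ((M ^ (5 * n ^ 3) : ℕ) : ℝ) := by
          exact_mod_cast h2
      _ = (M : ℝ) ^ ((5 * n ^ 3 : ℕ) : ℝ) := by rw [Real.rpow_natCast]; push_cast; rfl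
      _ ≤ (M : ℝ) ^ (5.5 * (n : ℝ) ^ 3) := by
          apply Real.rpow_le_rpow_of_exponent_le hM
          push_cast
          have : (0 : ℝ) ≤ (n : ℝ) ^ 3 := by positivity
          nlinarith
      _ ≤ _ := by
          apply le_mul_of_one_le_left (by positivity)
          exact_mod_cast hn.le

theorem preFinal {k : Type*} [Field k] [IsAlgClosed k] [CharZero k]
    {n l : ℕ} (hn : 1 < n)
    (hC : ∀ (M : ℕ) (F : Finset (MvPolynomial (Fin n ×ₗ Fin n) k)), (∀ f ∈ F, f.totalDegree ≤ M) →
      ∀ P ∈ (Ideal.span (F : Set (MvPolynomial (Fin n ×ₗ Fin n) k))).minimalPrimes,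
      ∃ G : List (MvPolynomial (Fin n ×ₗ Fin n) k), IsTriangularSet G ∧
        (P : Set (MvPolynomial (Fin n ×ₗ Fin n) k)) = trep G ∧
        ∀ g ∈ G, g.totalDegree ≤ EB (n * n) M)
    (H : Subgroup (GL (Fin n) k)) (H' : Subgroup (GL (Fin l) k))
    (d d' m : ℕ)
    (hH : SubgroupTriRepBoundedBy H (d : ℝ))
    (hH' : SubgroupTriRepBoundedBy H' (d' : ℝ))
    (τ : H →* GL (Fin l) k) (hτ : HomBoundedBy τ m) :
    SubgroupTriRepBoundedBy (Subgroup.map H.subtype (Subgroup.comap τ H'))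
      ((n : ℝ) * ((max d (m * d') : ℕ) : ℝ) ^ (5.5 * (n : ℝ) ^ 3)) := by
  classical
  have : Finite (Fin n ×ₗ Fin n) := inferInstanceAs (Finite (Fin n × Fin n))
  set M := max d (m * d') with hM
  set K := Subgroup.map H.subtype (Subgroup.comap τ H') with hK
  have hB := lemB H H' d d' m hH hH' τ hτ
  rw [← hK] at hB
  set I : Ideal (MvPolynomial (Fin n ×ₗ Fin n) k) := vanishingIdeal k (evalMat '' (K : Set (GL (Fin n) k)))
    with hI
  have hmemI : ∀ p, p ∈ I ↔ ∀ x ∈ K, eval (evalMat x) p = 0 := by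
    intro p
    constructor
    · intro h x hx
      exact h _ ⟨x, hx, rfl⟩
    · rintro h _ ⟨x, hx, rfl⟩
      exact h x hx
  have hrad : I.IsRadical := by
    intro p ⟨e, hp⟩
    rw [hmemI] at hp ⊢
    intro x hx
    have := hp x hx
    rw [map_pow] at this
    exact eq_zero_of_pow_eq_zero this
  obtain ⟨S, hS⟩ : I.FG := (isNoetherianRing_iff_ideal_fg _).1 inferInstance I
  -- each minimal prime is minimal over a low degree ideal
  have key : ∀ P ∈ I.minimalPrimes, ∃ F : Finset (MvPolynomial (Fin n ×ₗ Fin n) k),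
      (∀ f ∈ F, f.totalDegree ≤ M) ∧
      P ∈ (Ideal.span (F : Set (MvPolynomial (Fin n ×ₗ Fin n) k))).minimalPrimes := by
    intro P hP
    have hPp : P.IsPrime := hP.1.1
    obtain ⟨b, hb, hbP⟩ := exists_notMem_mul I hrad P hP
    have : b ∉ I := fun h => hb (hP.1.2 h)
    rw [hmemI] at this
    push Not at this
    obtain ⟨κ, hκ, hbκ⟩ := this
    have hPκ : ∀ p ∈ P, eval (evalMat κ) p = 0 := by
      intro p hp
      have := (hmemI _).1 (hbP p hp) κ hκ
      rw [map_mul] at this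
      exact (mul_eq_zero.1 this).resolve_left hbκ
    obtain ⟨F, hF, u, hu, hFu⟩ := hB κ hκ
    have huP : u ∉ P := fun h => hu (hPκ u h)
    have hdP : detP n k ∉ P := fun h => eval_detP_ne κ (hPκ _ h)
    refine ⟨F, hF, ⟨hPp, ?_⟩, ?_⟩
    · rw [Ideal.span_le]
      intro f hf
      have : u * f ∈ I := by
        rw [hmemI]
        intro x hx
        rw [map_mul]
        by_cases h0 : eval (evalMat x) u = 0
        · rw [h0, zero_mul]
        · rw [(hFu x h0).1 hx f hf, mul_zero]
      exact (hPp.mem_or_mem (hP.1.2 this)).resolve_left huP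
    · rintro Q ⟨hQp, hQ⟩ hQP
      refine hP.2 ⟨hQp, fun g hg => ?_⟩ hQP
      have h1 : g * (u * detP n k) ∈ Q := by
        by_contra hcon
        obtain ⟨v, hv1, hv2⟩ := exists_eval_ne_zero Q _ hcon
        rw [map_mul, map_mul] at hv2
        obtain ⟨x, rfl⟩ := exists_evalMat v (right_ne_zero_of_mul (right_ne_zero_of_mul hv2))
        apply left_ne_zero_of_mul hv2
        refine (hmemI g).1 hg x ?_
        rw [hFu x (left_ne_zero_of_mul (right_ne_zero_of_mul hv2))]
        intro f hf
        exact hv1 f (hQ (Ideal.subset_span hf))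
      exact (hQp.mem_or_mem h1).resolve_right fun h => hPp.mul_notMem huP hdP (hQP h)
  refine ⟨S, ?_, ?_⟩
  · -- zero set
    intro x
    have hSI : (∀ p ∈ S, eval (evalMat x) p = 0) ↔ ∀ p ∈ I, eval (evalMat x) p = 0 := by
      rw [← hS]
      constructor
      · intro h p hp
        have : Ideal.span (S : Set (MvPolynomial (Fin n ×ₗ Fin n) k)) ≤
            RingHom.ker (eval (evalMat x)) := by
          rw [Ideal.span_le]; intro q hq; exact h q hq
        exact this hp
      · intro h p hp
        exact h p (Ideal.subset_span hp)
    change _ ↔ ∀ p ∈ S, _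
    rw [hSI]
    constructor
    · intro hx p hp
      exact (hmemI p).1 hp x hx
    · intro h
      exact closedK H H' d d' m hH hH' τ hτ x fun p hp => h p ((hmemI p).2 hp)
  · have hS' : Ideal.span (S : Set (MvPolynomial (Fin n ×ₗ Fin n) k)) = I := hS
    rw [hS']
    have hfin := I.finite_minimalPrimes_of_isNoetherianRing
    have hone : I ≠ ⊤ := by
      intro h
      have : (1 : MvPolynomial (Fin n ×ₗ Fin n) k) ∈ I := by rw [h]; trivial
      have := (hmemI 1).1 this 1 K.one_mem
      simp at this
    obtain ⟨P₀, hP₀⟩ : I.minimalPrimes.Nonempty := Set.nonempty_coe_sort.1 (Ideal.nonempty_minimalPrimes hone)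
    have hGP : ∀ P : Ideal (MvPolynomial (Fin n ×ₗ Fin n) k),
        ∃ G : List (MvPolynomial (Fin n ×ₗ Fin n) k), P ∈ I.minimalPrimes → (IsTriangularSet G ∧
        (P : Set (MvPolynomial (Fin n ×ₗ Fin n) k)) = trep G ∧
        ∀ g ∈ G, g.totalDegree ≤ EB (n * n) M) := by
      intro P
      by_cases hP : P ∈ I.minimalPrimes
      · obtain ⟨F, hF, hPF⟩ := key P hP
        obtain ⟨G, h⟩ := hC M F hF P hPF
        exact ⟨G, fun _ => h⟩
      · exact ⟨[], fun h => absurd h hP⟩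
    choose G hG using hGP
    obtain ⟨N, hN⟩ : ∃ N, hfin.toFinset.card = N + 1 := by
      refine Nat.exists_eq_succ_of_ne_zero ?_
      rw [Finset.card_ne_zero]
      exact ⟨P₀, by simpa using hP₀⟩
    let e := (Finset.equivFinOfCardEq hN).symm
    have he : ∀ i, (e i : Ideal (MvPolynomial (Fin n ×ₗ Fin n) k)) ∈ I.minimalPrimes := fun i =>
      hfin.mem_toFinset.1 (e i).2
    refine ⟨N, fun i => G (e i), fun i => (hG _ (he i)).1, fun i g hg => ?_, fun i => ?_, ?_⟩
    · refine le_trans ?_ (EB_bound n M hn)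
      exact_mod_cast (hG _ (he i)).2.2 g hg
    · exact ⟨e i, (he i).1.1.isRadical, (hG _ (he i)).2.1⟩
    · rw [← Ideal.sInf_minimalPrimes]
      ext p
      simp only [SetLike.mem_coe, Set.mem_iInter, ← (hG _ (he _)).2.1]
      rw [Ideal.mem_sInf]
      constructor
      · intro h i
        exact h (he i)
      · intro h Q hQ
        have := h (e.symm ⟨Q, by simpa using hQ⟩)
        simpa using this
end

section
set_option linter.unusedSectionVars false
variable {k : Type*} [Field k] {σ : Type*}

def AnIndep (P : Ideal (MvPolynomial σ k)) {ι : Type*} (f : ι → MvPolynomial σ k) : Prop :=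
  ∀ B : MvPolynomial ι (MvPolynomial σ k), (∀ α, B.coeff α ∈ P → B.coeff α = 0) →
    eval f B = 0 → B = 0

theorem eval_sub_mem {R ι : Type*} [CommRing R] (W : Ideal R) (a b : ι → R)
    (h : ∀ i, a i - b i ∈ W) (B : MvPolynomial ι R) : eval a B - eval b B ∈ W := by
  rw [← Ideal.Quotient.eq]
  have : ∀ c : ι → R, Ideal.Quotient.mk W (eval c B) =
      eval₂ (Ideal.Quotient.mk W) (fun i => Ideal.Quotient.mk W (c i)) B := by
    intro c
    rw [eval, coe_eval₂Hom, eval₂_comp_left]; rfl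
  rw [this, this]
  congr 1
  funext i
  exact Ideal.Quotient.eq.2 (h i)

theorem lemC12 [Infinite k] (M c : ℕ) (P : Ideal (MvPolynomial σ k))
    (f : Fin c → MvPolynomial σ k) (hf : ∀ i, (f i).totalDegree ≤ M)
    (hP : P ∈ (Ideal.span (Set.range f)).minimalPrimes)
    (hmin : ∀ c' < c, ¬ ∃ f : Fin c' → MvPolynomial σ k, (∀ i, (f i).totalDegree ≤ M) ∧
      P ∈ (Ideal.span (Set.range f)).minimalPrimes) :
    AnIndep P f := by
  classical
  have hPp : P.IsPrime := hP.1.1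
  have hfP : ∀ i, f i ∈ P := fun i => hP.1.2 (Ideal.subset_span ⟨i, rfl⟩)
  intro B hB hB0
  by_contra hne
  have hsupp : B.support.Nonempty := by rwa [Finset.nonempty_iff_ne_empty, Ne, support_eq_empty]
  obtain ⟨α₀, hα₀, hleast⟩ := B.support.exists_min_image (fun α => α.degree) hsupp
  set m := α₀.degree with hm
  -- leading form
  set Bm := homogeneousComponent m B with hBm
  have hBmc : ∀ α, Bm.coeff α = if α.degree = m then B.coeff α else 0 := fun α => by
    rw [hBm, coeff_homogeneousComponent]
  obtain ⟨lam, hlam⟩ : ∃ lam : Fin c → k, eval (fun i => (C (lam i) : MvPolynomial σ k)) Bm ∉ P := by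
    by_contra! hcon
    let φ := Ideal.Quotient.mk P
    have hinj : Function.Injective (fun a : k => φ (C a)) := (φ.comp (C : k →+* _)).injective
    have hz : MvPolynomial.map φ Bm = 0 := by
      refine funext_set (fun _ => Set.range fun a : k => φ (C a))
        (fun _ => Set.infinite_range_of_injective hinj) ?_
      intro x hx
      have : ∀ i, ∃ a : k, φ (C a) = x i := fun i => hx i (Set.mem_univ _)
      choose lam hl using this
      rw [map_zero, eval_map, ← (funext hl : (fun i => φ (C (lam i))) = x)]
      have h1 := Ideal.Quotient.eq_zero_iff_mem.2 (hcon lam)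
      rw [eval, coe_eval₂Hom, eval₂_comp_left] at h1
      exact h1
    have h1 := congrArg (coeff α₀) hz
    rw [coeff_map, hBmc, if_pos rfl, coeff_zero, Ideal.Quotient.eq_zero_iff_mem] at h1
    exact (mem_support_iff.1 hα₀) (hB _ h1)
  by_cases hm0 : m = 0
  · -- constant term lies in P
    have hBm0 : Bm = C (B.coeff 0) := by
      ext α
      rw [hBmc, hm0, coeff_C]
      by_cases hα : α = 0
      · simp [hα]
      · rw [if_neg (by rwa [Finsupp.degree_eq_zero_iff]), if_neg (Ne.symm hα)]
    rw [hBm0, eval_C] at hlam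
    apply hlam
    have h1 := eval_sub_mem P f (fun _ => 0) (fun i => by simpa using hfP i) B
    rw [hB0, zero_sub] at h1
    have h2 : eval (fun _ => 0) B = B.coeff 0 := by
      rw [← constantCoeff_eq]; exact congrFun (congrArg DFunLike.coe eval_zero) B
    rw [h2] at h1
    simpa using h1
  · obtain ⟨j, hj⟩ : ∃ j, lam j ≠ 0 := by
      by_contra! hcon
      apply hlam
      rw [eval_eq]
      refine Ideal.sum_mem _ fun α hα => ?_
      have hα' : α.degree = m := by
        by_contra h
        rw [mem_support_iff, hBmc, if_neg h] at hα
        exact hα rfl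
      have : α ≠ 0 := by
        rintro rfl
        simp at hα'
        omega
      obtain ⟨i, hi⟩ := Finsupp.support_nonempty_iff.2 this
      rw [Finset.prod_eq_zero hi]
      · simp
      · rw [hcon i, map_zero, zero_pow]
        simpa using hi
    set f' := C (lam j)⁻¹ * f j with hf'
    set w : Fin c → MvPolynomial σ k := fun i => f i - C (lam i) * f' with hw
    have hwj : w j = 0 := by
      simp only [hw, hf']
      rw [← mul_assoc, ← C_mul, mul_inv_cancel₀ hj, C_1, one_mul, sub_self]
    set W := Ideal.span (Set.range w) with hW
    have hf'P : f' ∈ P := P.mul_mem_left _ (hfP j)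
    have hWP : W ≤ P := by
      rw [hW, Ideal.span_le]
      rintro _ ⟨i, rfl⟩
      exact P.sub_mem (hfP i) (P.mul_mem_left _ hf'P)
    have h1 := eval_sub_mem W f (fun i => C (lam i) * f') (fun i => Ideal.subset_span ⟨i, rfl⟩) B
    rw [hB0, zero_sub, neg_mem_iff] at h1
    have h2 : ∃ s, eval (fun i => C (lam i) * f') B =
        f' ^ m * (eval (fun i => (C (lam i) : MvPolynomial σ k)) Bm + f' * s) := by
      refine ⟨∑ α ∈ B.support.filter (fun α => ¬ α.degree = m),
        B.coeff α * (∏ i, C (lam i) ^ α i) * f' ^ (α.degree - m - 1), ?_⟩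
      have h3 : eval (fun i => (C (lam i) : MvPolynomial σ k)) Bm =
          ∑ α ∈ B.support.filter (fun α => α.degree = m), B.coeff α * (∏ i, C (lam i) ^ α i) := by
        rw [hBm, homogeneousComponent_apply, map_sum]
        refine Finset.sum_congr rfl fun α _ => ?_
        rw [eval_monomial, Finsupp.prod_fintype _ _ (by simp)]
      rw [h3, eval_eq', ← Finset.sum_filter_add_sum_filter_not B.support (fun α => α.degree = m),
        mul_add, Finset.mul_sum, Finset.mul_sum, Finset.mul_sum]
      have hpr : ∀ α : Fin c →₀ ℕ, ∏ i, (C (lam i) * f') ^ α i =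
          (∏ i, C (lam i) ^ α i) * f' ^ α.degree := by
        intro α
        simp only [mul_pow, Finset.prod_mul_distrib]
        rw [Finset.prod_pow_eq_pow_sum, Finsupp.degree_eq_sum]
      congr 1
      · refine Finset.sum_congr rfl fun α hα => ?_
        rw [hpr, (Finset.mem_filter.1 hα).2]; ring
      · refine Finset.sum_congr rfl fun α hα => ?_
        obtain ⟨hα1, hα2⟩ := Finset.mem_filter.1 hα
        have := hleast α hα1
        rw [hpr]
        have h4 : α.degree = m + 1 + (α.degree - m - 1) := by omega
        conv_lhs => rw [h4]
        ring
    obtain ⟨s, h2⟩ := h2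
    rw [h2] at h1
    have he : eval (fun i => (C (lam i) : MvPolynomial σ k)) Bm + f' * s ∉ P := fun h =>
      hlam ((P.add_mem_iff_left (P.mul_mem_right _ hf'P)).1 h)
    have hPW : P ∈ W.minimalPrimes := by
      refine ⟨⟨hPp, hWP⟩, ?_⟩
      rintro Q ⟨hQp, hWQ⟩ hQP
      have hf'Q : f' ∈ Q := by
        rcases hQp.mem_or_mem (hWQ h1) with h | h
        · exact hQp.mem_of_pow_mem _ h
        · exact absurd (hQP h) he
      refine hP.2 ⟨hQp, ?_⟩ hQP
      rw [Ideal.span_le]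
      rintro _ ⟨i, rfl⟩
      have : f i = w i + C (lam i) * f' := by simp [hw]
      rw [this]
      exact Q.add_mem (hWQ (Ideal.subset_span ⟨i, rfl⟩)) (Q.mul_mem_left _ hf'Q)
    obtain ⟨c, rfl⟩ : ∃ c', c = c' + 1 := Nat.exists_eq_succ_of_ne_zero (by
      rintro rfl; exact j.elim0)
    refine hmin c (Nat.lt_succ_self c) ⟨fun i => w (j.succAbove i), fun i => ?_, ?_⟩
    · have hd : f'.totalDegree ≤ M := by
        refine (totalDegree_mul _ _).trans ?_
        simpa using hf j
      refine (totalDegree_sub _ _).trans (max_le (hf _) ?_)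
      refine (totalDegree_mul _ _).trans ?_
      simpa using hd
    · have : Ideal.span (Set.range fun i => w (j.succAbove i)) = W := by
        apply le_antisymm
        · rw [Ideal.span_le]
          rintro _ ⟨i, rfl⟩
          exact Ideal.subset_span ⟨_, rfl⟩
        · rw [hW, Ideal.span_le]
          rintro _ ⟨i, rfl⟩
          by_cases hi : i = j
          · rw [hi, hwj]; exact Ideal.zero_mem _
          · obtain ⟨i', rfl⟩ := Fin.exists_succAbove_eq hi
            exact Ideal.subset_span ⟨i', rfl⟩
      rw [this]; exact hPW

theorem lemC12' [Infinite k] (M : ℕ) (F : Finset (MvPolynomial σ k))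
    (hF : ∀ f ∈ F, f.totalDegree ≤ M) (P : Ideal (MvPolynomial σ k))
    (hP : P ∈ (Ideal.span (F : Set (MvPolynomial σ k))).minimalPrimes) :
    ∃ (c : ℕ) (f : Fin c → MvPolynomial σ k), (∀ i, (f i).totalDegree ≤ M) ∧
      P ∈ (Ideal.span (Set.range f)).minimalPrimes ∧ AnIndep P f := by
  classical
  have hex : ∃ c, ∃ f : Fin c → MvPolynomial σ k, (∀ i, (f i).totalDegree ≤ M) ∧
      P ∈ (Ideal.span (Set.range f)).minimalPrimes := by
    refine ⟨F.card, fun i => F.equivFin.symm i, fun i => hF _ (F.equivFin.symm i).2, ?_⟩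
    have : Set.range (fun i => (F.equivFin.symm i : MvPolynomial σ k)) = F := by
      ext x
      constructor
      · rintro ⟨i, rfl⟩; exact (F.equivFin.symm i).2
      · intro hx; exact ⟨F.equivFin ⟨x, hx⟩, by simp⟩
    rw [this]; exact hP
  obtain ⟨f, h1, h2⟩ := Nat.find_spec hex
  exact ⟨_, f, h1, h2, lemC12 M _ P f h1 h2 fun c' hc' => Nat.find_min hex hc'⟩

theorem AnIndep.comp {P : Ideal (MvPolynomial σ k)} {ι κ : Type*} {f : ι → MvPolynomial σ k}
    (hf : AnIndep P f) (e : κ → ι) (he : Function.Injective e) : AnIndep P (f ∘ e) := by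
  intro B hB hB0
  have : rename e B = 0 := by
    refine hf _ (fun α hα => ?_) (by rw [eval_rename]; exact hB0)
    by_contra hne
    obtain ⟨β, rfl, hβ⟩ := coeff_rename_ne_zero e B α hne
    rw [coeff_rename_mapDomain e he] at hα hne
    exact hne (hB _ hα)
  exact (map_eq_zero_iff _ (rename_injective e he)).1 this

theorem AnIndep.mem {P : Ideal (MvPolynomial σ k)} {c : ℕ} {f : Fin c → MvPolynomial σ k}
    (hP : P ∈ (Ideal.span (Set.range f)).minimalPrimes) (i) : f i ∈ P :=
  hP.1.2 (Ideal.subset_span ⟨i, rfl⟩)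
end

section
set_option linter.unusedSectionVars false
variable {k : Type*} [Field k] {σ : Type*} [LinearOrder σ]

theorem coeff_aeval_vars (s : σ) (p : Polynomial (supported k (Set.Iio s))) (j : ℕ) :
    ((p.coeff j : MvPolynomial σ k)).vars ⊆
      (Polynomial.aeval (X s : MvPolynomial σ k) p).vars.erase s := by
  classical
  have h := congrArg (fun q => Polynomial.coeff q j) (toPh_aeval s p)
  simp only [Polynomial.coeff_map] at h
  change _ = (p.coeff j : MvPolynomial σ k) at h
  rw [← h, toPh_coeff]
  intro i hi
  have h1 := vars_sum_subset _ _ hi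
  obtain ⟨m, hm, hi⟩ := Finset.mem_biUnion.1 h1
  rw [Finset.mem_filter] at hm
  rw [vars_monomial (by simpa using hm.1), Finsupp.support_erase, Finset.mem_erase] at hi
  rw [Finset.mem_erase]
  refine ⟨hi.1, ?_⟩
  rw [mem_vars_iff_mem_support]; exact ⟨m, hm.1, hi.2⟩

theorem free_indep (P : Ideal (MvPolynomial σ k)) [hP : P.IsPrime] (T : Finset σ) :
    (∀ i ∈ T, FreeAt P i) → ∀ f ∈ P, f.vars ⊆ T → f = 0 := by
  classical
  induction T using Finset.induction_on_max with
  | empty =>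
    intro _ f hf hv
    have : f ∈ supported k (∅ : Set σ) := by
      rw [mem_supported]; intro i hi; simpa using hv hi
    rw [supported_empty] at this
    obtain ⟨a, rfl⟩ := Algebra.mem_bot.1 this
    by_contra hne
    have ha : a ≠ 0 := by rintro rfl; simp at hne
    apply hP.ne_top
    rw [Ideal.eq_top_iff_one]
    have := P.mul_mem_left (C a⁻¹) hf
    rwa [algebraMap_eq, ← C_mul, inv_mul_cancel₀ ha, C_1] at this
  | insert a s hlt ih =>
    intro hfree f hf hv
    have h1 : f ∈ supported k (Set.Iic a) := by
      rw [mem_supported]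
      intro i hi
      rcases Finset.mem_insert.1 (hv hi) with rfl | h
      · exact le_refl _
      · exact (hlt i h).le
    obtain ⟨p, rfl⟩ := exists_aeval a f h1
    have h2 := hfree a (Finset.mem_insert_self _ _) p hf
    have h3 : p = 0 := by
      ext1 j
      apply Subtype.ext
      refine ih (fun i hi => hfree i (Finset.mem_insert_of_mem hi)) _ (h2 j) ?_
      intro i hi
      have := coeff_aeval_vars a p j hi
      rw [Finset.mem_erase] at this
      exact (Finset.mem_insert.1 (hv this.2)).resolve_left this.1
    rw [h3, map_zero]

variable {L : Type*} [Field L] [Algebra k L]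

noncomputable def phiT (x : σ → L) (T : Finset σ) : MvPolynomial σ k →ₐ[k] MvPolynomial σ L :=
  aeval (fun i => if i ∈ T then C (x i) else X i)

theorem phiT_of_vars (x : σ → L) (T : Finset σ) (f : MvPolynomial σ k) (hf : f.vars ⊆ T) :
    phiT x T f = C (aeval x f) := by
  have : (C (aeval x f) : MvPolynomial σ L) =
    ((IsScalarTower.toAlgHom k L (MvPolynomial σ L)).comp (aeval x)) f := rfl
  rw [this]
  have h2 : ((IsScalarTower.toAlgHom k L (MvPolynomial σ L)).comp (aeval x)) =
    aeval (fun i => C (x i)) := by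
    apply algHom_ext; intro i; simp [algebraMap_eq]
  rw [h2]
  refine eval₂Hom_congr' rfl ?_ rfl
  intro i hi _
  rw [if_pos (hf hi)]

theorem height_ge [Fintype σ] (P : Ideal (MvPolynomial σ k)) (x : σ → L)
    (hx : ∀ f, aeval x f = 0 ↔ f ∈ P) (T : Finset σ) :
    IsLowerSet (T : Set σ) → ∀ V : Finset σ, V ⊆ T → (∀ s ∈ V, ¬ FreeAt P s) →
    (V.card : ℕ∞) ≤ (RingHom.ker (phiT (k := k) x T)).height := by
  classical
  induction T using Finset.induction_on_max with
  | empty => intro _ V hV _; rw [Finset.subset_empty.1 hV]; simp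
  | insert a s hlt ih =>
    intro hlow V hV hfree
    have hlow' : IsLowerSet (s : Set σ) := by
      intro i j hji hi
      have := hlow hji (Finset.mem_insert_of_mem hi)
      rcases Finset.mem_insert.1 this with rfl | h
      · exact absurd (hlt i hi) (not_lt.2 hji)
      · exact h
    have hin : ∀ i < a, i ∈ s := fun i hi =>
      (Finset.mem_insert.1 (hlow hi.le (Finset.mem_insert_self _ _))).resolve_left hi.ne
    have has : a ∉ s := fun h => lt_irrefl _ (hlt a h)
    have hle : RingHom.ker (phiT (k := k) x s) ≤ RingHom.ker (phiT (k := k) x (insert a s)) := by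
      have h1 : phiT (k := k) x (insert a s) =
        ((aeval (fun i => if i = a then C (x a) else X i) : MvPolynomial σ L →ₐ[L] MvPolynomial σ L).restrictScalars k).comp (phiT x s) := by
        apply algHom_ext
        intro i
        simp only [phiT, AlgHom.comp_apply, aeval_X, Finset.mem_insert]
        by_cases hi : i ∈ s
        · simp [hi, algebraMap_eq]
        · by_cases hia : i = a
          · subst hia; simp [hi]
          · simp [hi, hia]
      intro f hf
      rw [RingHom.mem_ker] at hf ⊢
      rw [h1, AlgHom.comp_apply, hf, map_zero]
    have hpr1 : (RingHom.ker (phiT (k := k) x s)).IsPrime := RingHom.ker_isPrime _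
    have hpr2 : (RingHom.ker (phiT (k := k) x (insert a s))).IsPrime := RingHom.ker_isPrime _
    by_cases haV : a ∈ V
    · have hlt' : RingHom.ker (phiT (k := k) x s) < RingHom.ker (phiT (k := k) x (insert a s)) := by
        refine lt_of_le_of_ne hle fun heq => ?_
        have := hfree a haV
        rw [FreeAt] at this
        push Not at this
        obtain ⟨p, hp, j, hj⟩ := this
        have h1 : Polynomial.aeval (X a : MvPolynomial σ k) p ∈ RingHom.ker (phiT (k := k) x s) := by
          rw [heq, RingHom.mem_ker, phiT_of_vars, (hx _).2 hp, map_zero]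
          rw [← Finset.coe_subset, ← mem_supported (R := k)]
          rw [Polynomial.aeval_eq_sum_range]
          refine sum_mem fun i _ => ?_
          rw [Algebra.smul_def]
          refine mul_mem ?_ (pow_mem ?_ _)
          · refine supported_mono ?_ (p.coeff i).2
            intro b hb
            exact Finset.mem_insert_of_mem (hin b hb)
          · exact X_mem_supported.2 (by simp)
        rw [RingHom.mem_ker, Polynomial.aeval_eq_sum_range, map_sum] at h1
        have h2 := congrArg (coeff (Finsupp.single a j)) h1
        rw [coeff_sum, coeff_zero] at h2
        have h3 : ∀ i, coeff (Finsupp.single a j) (phiT (k := k) x s (p.coeff i • X a ^ i)) =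
            if i = j then aeval x (p.coeff j : MvPolynomial σ k) else 0 := by
          intro i
          have : phiT (k := k) x s (p.coeff i • X a ^ i) =
            C (aeval x (p.coeff i : MvPolynomial σ k)) * X a ^ i := by
            rw [Algebra.smul_def, map_mul, map_pow]
            congr 1
            · refine phiT_of_vars x s _ ?_
              intro b hb
              exact hin b ((mem_supported.1 (p.coeff i).2) hb)
            · simp [phiT, has]
          rw [this, coeff_C_mul, coeff_X_pow]
          by_cases hij : i = j
          · subst hij; simp
          · rw [if_neg, if_neg hij, mul_zero]
            intro h
            exact hij (by simpa using congrArg (fun f => f a) h)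
        simp only [h3] at h2
        rw [Finset.sum_ite_eq'] at h2
        split_ifs at h2 with h4
        · exact hj ((hx _).1 h2)
        · apply hj
          rw [Polynomial.coeff_eq_zero_of_natDegree_lt (by simpa using h4)]
          simp
      have h5 := ih hlow' (V.erase a) (fun i hi => by
        rw [Finset.mem_erase] at hi
        exact (Finset.mem_insert.1 (hV hi.2)).resolve_left hi.1) (fun i hi => hfree i (Finset.mem_of_mem_erase hi))
      have h6 := Ideal.height_add_one_le_of_lt_of_isPrime hlt'
      refine le_trans ?_ h6
      rw [← Finset.card_erase_add_one haV]
      push_cast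
      gcongr
    · refine (ih hlow' V ?_ hfree).trans (Ideal.height_mono hle)
      intro i hi
      exact (Finset.mem_insert.1 (hV hi)).resolve_left (fun h => haV (h ▸ hi))

theorem height_ge' [Fintype σ] (P : Ideal (MvPolynomial σ k)) (x : σ → L)
    (hx : ∀ f, aeval x f = 0 ↔ f ∈ P) (V : Finset σ) (hV : ∀ s ∈ V, ¬ FreeAt P s) 
    {c : ℕ} (f : Fin c → MvPolynomial σ k)
    (hP : P ∈ (Ideal.span (Set.range f)).minimalPrimes) :
    V.card ≤ c := by
  classical
  have h1 := height_ge P x hx Finset.univ (by simpa using isLowerSet_univ) V (Finset.subset_univ _) hV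
  have h2 : RingHom.ker (phiT (k := k) x Finset.univ) = P := by
    ext g
    rw [RingHom.mem_ker, phiT_of_vars x _ g (Finset.subset_univ _), C_eq_zero, hx]
  rw [h2] at h1
  have h3 : Set.range f = ((Finset.univ.image f : Finset _) : Set (MvPolynomial σ k)) := by simp
  rw [h3] at hP
  have h4 := Ideal.height_le_card_of_mem_minimalPrimes_span_finset hP
  have h5 : (Finset.univ.image f).card ≤ c := by
    simpa using Finset.card_image_le (s := Finset.univ) (f := f)
  have h6 := h1.trans h4
  have h7 : V.card ≤ (Finset.univ.image f).card := by exact_mod_cast h6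
  omega
end

section
set_option linter.unusedSectionVars false
variable {k : Type*} [Field k] {σ : Type*} [Fintype σ]

theorem finrank_restrict_le {ι : Type*} [Fintype ι] (D : ℕ) (S : ι → (σ →₀ ℕ))
    (hS : ∀ α : σ →₀ ℕ, α.degree ≤ D → ∃ i, S i = α) :
    Module.Finite k (restrictTotalDegree σ k D) ∧
    Module.finrank k (restrictTotalDegree σ k D) ≤ Fintype.card ι := by
  let Φ : restrictTotalDegree σ k D →ₗ[k] (ι → k) :=
    { toFun := fun f i => coeff (S i) (f : MvPolynomial σ k)
      map_add' := fun f g => by ext i; simp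
      map_smul' := fun c f => by ext i; simp }
  have hinj : Function.Injective Φ := by
    rw [← LinearMap.ker_eq_bot, LinearMap.ker_eq_bot']
    intro f hf
    apply Subtype.ext
    ext α
    by_contra hne
    have h1 : α.degree ≤ D := by
      have := (mem_restrictTotalDegree _ _ _).1 f.2
      refine le_trans ?_ this
      have := le_totalDegree (p := (f : MvPolynomial σ k)) (mem_support_iff.2 (by simpa using hne))
      exact this
    obtain ⟨i, rfl⟩ := hS α h1
    exact hne (congrFun hf i)
  have hfin : Module.Finite k (restrictTotalDegree σ k D) := Module.Finite.of_injective Φ hinj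
  refine ⟨hfin, ?_⟩
  have := LinearMap.finrank_le_finrank_of_injective hinj
  simpa using this

theorem finrank_restrict (D : ℕ) : Module.Finite k (restrictTotalDegree σ k D) ∧
    Module.finrank k (restrictTotalDegree σ k D) ≤ (D + 1) ^ Fintype.card σ := by
  classical
  have := finrank_restrict_le (k := k) (σ := σ) D
    (fun i : σ → Fin (D + 1) => Finsupp.equivFunOnFinite.symm (fun s => (i s : ℕ))) (by
      intro α hα
      refine ⟨fun s => ⟨α s, ?_⟩, ?_⟩
      · have := Finsupp.le_degree s α
        omega
      · ext s; simp)
  simpa using this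

theorem finrank_restrict_one : 
    Module.finrank k (restrictTotalDegree σ k 1) ≤ Fintype.card σ + 1 := by
  classical
  have := (finrank_restrict_le (k := k) (σ := σ) 1
    (fun i : Option σ => i.elim 0 (fun s => Finsupp.single s 1)) (by
      intro α hα
      by_cases h0 : α = 0
      · exact ⟨none, h0.symm⟩
      · obtain ⟨s, hs⟩ := Finsupp.support_nonempty_iff.2 h0
        refine ⟨some s, ?_⟩
        simp only [Option.elim]
        have hs' : α s ≠ 0 := by simpa using hs
        rw [Finsupp.degree_eq_sum, ← Finset.add_sum_erase _ _ (Finset.mem_univ s)] at hα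
        ext t
        by_cases hts : s = t
        · subst hts; simp; omega
        · have : α t ≤ ∑ x ∈ Finset.univ.erase s, α x :=
            Finset.single_le_sum (f := fun x => α x) (fun _ _ => Nat.zero_le _) (by simp [Ne.symm hts])
          simp [hts]; omega)).2
  simpa using this

variable {L : Type*} [Field L] [Algebra k L]

noncomputable def Wsp (x : σ → L) (D : ℕ) : Submodule k L :=
  (restrictTotalDegree σ k D).map (aeval x : MvPolynomial σ k →ₐ[k] L).toLinearMap

theorem Wsp_lift (x : σ → L) (D : ℕ) : ∃ y : Fin (Module.finrank k (Wsp (k := k) x D)) → MvPolynomial σ k,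
    (∀ j, (y j).totalDegree ≤ D) ∧ LinearIndependent k (fun j => aeval x (y j)) := by
  have := (finrank_restrict (k := k) (σ := σ) D).1
  have hfin : Module.Finite k (Wsp (k := k) x D) := by
    unfold Wsp; infer_instance
  let b := Module.finBasis k (Wsp (k := k) x D)
  have : ∀ j, ∃ y : MvPolynomial σ k, y.totalDegree ≤ D ∧ aeval x y = (b j : L) := by
    intro j
    obtain ⟨y, hy, hy'⟩ := (b j).2
    exact ⟨y, (mem_restrictTotalDegree _ _ _).1 hy, hy'⟩
  choose y hy hy' using this
  refine ⟨y, hy, ?_⟩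
  have h := b.linearIndependent.map' (Submodule.subtype _) (Submodule.ker_subtype _)
  rw [show (fun j => aeval x (y j)) = fun j => (b j : L) from funext hy']
  exact h

theorem hf_bound (P : Ideal (MvPolynomial σ k)) (x : σ → L)
    (hx : ∀ f, aeval x f = 0 ↔ f ∈ P) {c M : ℕ} (f : Fin c → MvPolynomial σ k)
    (hf : ∀ i, (f i).totalDegree ≤ M) (hind : AnIndep P f) (D b : ℕ) :
    (b + 1) ^ c * Module.finrank k (Wsp (k := k) x D) ≤ (D + M * (c * b) + 1) ^ Fintype.card σ := by
  classical
  obtain ⟨y, hy, hyi⟩ := Wsp_lift (k := k) x D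
  generalize Module.finrank k (Wsp (k := k) x D) = d at *
  have hfin := finrank_restrict (k := k) (σ := σ) (D + M * (c * b))
  let E : (Fin c → Fin (b+1)) → (Fin c →₀ ℕ) := fun α => Finsupp.equivFunOnFinite.symm (fun i => (α i : ℕ))
  have hE : Function.Injective E := by
    intro α β h
    funext i
    exact Fin.ext (by simpa [E] using congrArg (fun g => g i) h)
  let z : (Fin c → Fin (b+1)) × Fin d → MvPolynomial σ k := fun q => (∏ i, f i ^ (E q.1 i)) * y q.2
  have hz : ∀ q, z q ∈ restrictTotalDegree σ k (D + M * (c * b)) := by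
    intro q
    rw [mem_restrictTotalDegree]
    refine (totalDegree_mul _ _).trans ?_
    rw [add_comm]
    refine add_le_add (hy _) ?_
    refine (totalDegree_finsetProd _ _).trans ?_
    refine (Finset.sum_le_sum (g := fun _ => b * M) fun i _ => ?_).trans ?_
    · refine (totalDegree_pow _ _).trans ?_
      refine Nat.mul_le_mul ?_ (hf i)
      have := (q.1 i).2
      simp only [E, Finsupp.equivFunOnFinite_symm_apply_apply]; omega
    · simp; apply le_of_eq; ring
  have hli : LinearIndependent k z := by
    rw [Fintype.linearIndependent_iff]
    intro g hg
    let B : MvPolynomial (Fin c) (MvPolynomial σ k) :=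
      ∑ α, monomial (E α) (∑ j, g (α, j) • y j)
    have hBc : ∀ α, B.coeff (E α) = ∑ j, g (α, j) • y j := by
      intro α
      simp only [B, coeff_sum, coeff_monomial, hE.eq_iff]
      simp
    have hkey : ∀ α, (∑ j, g (α, j) • y j) ∈ P → ∀ j, g (α, j) = 0 := by
      intro α h
      rw [← hx, map_sum] at h
      simp only [map_smul] at h
      exact Fintype.linearIndependent_iff.1 hyi _ h
    have hB0 : B = 0 := by
      apply hind
      · intro α hα
        by_cases h : ∃ β, E β = α
        · obtain ⟨β, rfl⟩ := h
          rw [hBc] at hα ⊢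
          simp [hkey β hα]
        · simp only [B, coeff_sum, coeff_monomial]
          refine Finset.sum_eq_zero fun β _ => if_neg fun h' => h ⟨β, h'⟩
      · rw [← hg, Fintype.sum_prod_type]
        simp only [B, map_sum (eval f)]
        refine Finset.sum_congr rfl fun α _ => ?_
        rw [eval_monomial, Finsupp.prod_fintype _ _ (by simp), Finset.sum_mul]
        refine Finset.sum_congr rfl fun j _ => ?_
        simp only [z]
        rw [smul_mul_assoc, mul_comm]
    rintro ⟨α, j⟩
    apply hkey α
    rw [← hBc, hB0]
    simp
  have hli' : LinearIndependent k (fun q => (⟨z q, hz q⟩ : restrictTotalDegree σ k (D + M * (c * b)))) := by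
    apply LinearIndependent.of_comp (Submodule.subtype _)
    exact hli
  have := hfin.1
  have h1 := hli'.fintype_card_le_finrank
  have h2 : Fintype.card ((Fin c → Fin (b+1)) × Fin d) = (b+1)^c * d := by simp
  rw [h2] at h1
  exact h1.trans hfin.2

theorem hf_bound_one (P : Ideal (MvPolynomial σ k)) [hP : P.IsPrime] (x : σ → L)
    (hx : ∀ f, aeval x f = 0 ↔ f ∈ P) {c : ℕ} (f : Fin c → MvPolynomial σ k)
    (hf : ∀ i, (f i).totalDegree ≤ 1) (hfP : ∀ i, f i ∈ P) (hind : AnIndep P f) :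
    Module.finrank k (Wsp (k := k) x 1) + c ≤ Fintype.card σ + 1 := by
  classical
  obtain ⟨y, hy, hyi⟩ := Wsp_lift (k := k) x 1
  generalize Module.finrank k (Wsp (k := k) x 1) = d at *
  have hfin := (finrank_restrict (k := k) (σ := σ) 1).1
  have hli : LinearIndependent k (Sum.elim y f) := by
    rw [Fintype.linearIndependent_iff]
    intro g hg
    rw [Fintype.sum_sum_type] at hg
    simp only [Sum.elim_inl, Sum.elim_inr] at hg
    have h1 : ∀ j, g (Sum.inl j) = 0 := by
      have h2 := congrArg (aeval x) hg
      rw [map_add, map_sum, map_sum, map_zero] at h2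
      simp only [map_smul, (hx _).2 (hfP _), smul_zero, Finset.sum_const_zero, add_zero] at h2
      exact Fintype.linearIndependent_iff.1 hyi (fun j => g (Sum.inl j)) h2
    simp only [h1, zero_smul, Finset.sum_const_zero, zero_add] at hg
    let B : MvPolynomial (Fin c) (MvPolynomial σ k) := ∑ i, monomial (Finsupp.single i 1) (C (g (Sum.inr i)))
    have hBc : ∀ i, B.coeff (Finsupp.single i 1) = C (g (Sum.inr i)) := by
      intro i
      simp only [B, coeff_sum, coeff_monomial]
      rw [Finset.sum_eq_single i]
      · simp
      · intro j _ hj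
        rw [if_neg]
        rw [(Finsupp.single_left_injective one_ne_zero).eq_iff]; exact hj
      · simp
    have hC : ∀ a : k, C a ∈ P → a = 0 := by
      intro a ha
      have := (hx _).2 ha
      rw [algHom_C] at this
      simpa using this
    have hB0 : B = 0 := by
      apply hind
      · intro α hα
        by_cases h : ∃ i, Finsupp.single i 1 = α
        · obtain ⟨i, rfl⟩ := h
          rw [hBc] at hα ⊢
          rw [hC _ hα, C_0]
        · simp only [B, coeff_sum, coeff_monomial]
          refine Finset.sum_eq_zero fun β _ => if_neg fun h' => h ⟨β, h'⟩
      · rw [← hg]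
        simp only [B, map_sum (eval f)]
        refine Finset.sum_congr rfl fun i _ => ?_
        rw [eval_monomial, smul_eq_C_mul]
        simp
    rintro (j | i)
    · exact h1 j
    · apply hC
      rw [← hBc, hB0]; simp
  have hz : ∀ q, Sum.elim y f q ∈ restrictTotalDegree σ k 1 := by
    rintro (j | i) <;> rw [mem_restrictTotalDegree]
    · exact hy j
    · exact hf i
  have hli' : LinearIndependent k (fun q => (⟨_, hz q⟩ : restrictTotalDegree σ k 1)) := by
    apply LinearIndependent.of_comp (Submodule.subtype _)
    exact hli
  have h1 := hli'.fintype_card_le_finrank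
  have h2 := finrank_restrict_one (k := k) (σ := σ)
  simp at h1
  exact h1.trans h2

theorem lemC4 (P : Ideal (MvPolynomial σ k)) [hP : P.IsPrime] (x : σ → L)
    (hx : ∀ f, aeval x f = 0 ↔ f ∈ P) {c M r : ℕ} (hM : 1 ≤ M) (hr : r + c = Fintype.card σ)
    (f : Fin c → MvPolynomial σ k)
    (hf : ∀ i, (f i).totalDegree ≤ M) (hfP : ∀ i, f i ∈ P) (hind : AnIndep P f)
    {τ : Type*} [Fintype τ] (hτ : Fintype.card τ = r + 1) :
    ∃ D ≤ EB (Fintype.card σ) M, ∃ 𝓑 : Finset (τ →₀ ℕ), (∀ β ∈ 𝓑, β.degree ≤ D) ∧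
      Module.finrank k (Wsp (k := k) x D) < 𝓑.card := by
  classical
  set N := Fintype.card σ with hN
  rcases hM.eq_or_lt with h1 | h1
  · subst h1
    refine ⟨1, by simp [EB], Finset.univ.image (fun i : Option τ => i.elim 0 (fun s => Finsupp.single s 1)), ?_, ?_⟩
    · intro β hβ
      obtain ⟨i, _, rfl⟩ := Finset.mem_image.1 hβ
      cases i <;> simp
    · rw [Finset.card_image_of_injective]
      · have := hf_bound_one P x hx f hf hfP hind
        simp [hτ]
        omega
      · rintro (_ | i) (_ | j) h
        · rfl
        · exact absurd (congrArg (fun g => g j) h) (by simp)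
        · exact absurd (congrArg (fun g => g i) h) (by simp)
        · simp only [Option.elim] at h
          rw [(Finsupp.single_left_injective one_ne_zero).eq_iff] at h
          rw [h]
  · set b := (N + 2) ^ N * M ^ N with hb
    set a := M * b with ha
    have hb0 : 0 < b := by positivity
    refine ⟨(r + 1) * a, ?_, Finset.univ.image (fun i : τ → Fin (a + 1) =>
      Finsupp.equivFunOnFinite.symm (fun s => (i s : ℕ))), ?_, ?_⟩
    · rw [EB, if_neg (by omega)]
      calc (r + 1) * a ≤ (N + 2) ^ 2 * a := by
            refine Nat.mul_le_mul_right _ ?_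
            nlinarith
        _ = _ := by rw [ha, hb]; ring
    · intro β hβ
      obtain ⟨i, _, rfl⟩ := Finset.mem_image.1 hβ
      rw [Finsupp.degree_eq_sum, ← hτ]
      refine (Finset.sum_le_card_nsmul _ _ a fun s _ => ?_).trans (by simp)
      have := (i s).2
      simp only [Finsupp.equivFunOnFinite_symm_apply_apply]; omega
    · rw [Finset.card_image_of_injective]
      · by_contra! hcon
        simp only [Finset.card_univ, Fintype.card_fun, Fintype.card_fin, hτ] at hcon
        have h2 := hf_bound P x hx f hf hind ((r + 1) * a) b
        have h3 : (b + 1) ^ c * (a + 1) ^ (r + 1) ≤ ((r + 1) * a + M * (c * b) + 1) ^ N :=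
          (Nat.mul_le_mul_left _ hcon).trans h2
        have h4 : (r + 1) * a + M * (c * b) + 1 ≤ (N + 2) * a := by
          have : M * (c * b) = c * a := by rw [ha]; ring
          rw [this, ← hr]
          have : 0 < a := by positivity
          nlinarith
        have h5 : (b + 1) ^ (N + 1) ≤ (b + 1) ^ c * (a + 1) ^ (r + 1) := by
          have : N + 1 = c + (r + 1) := by omega
          rw [this, pow_add]
          refine Nat.mul_le_mul_left _ (Nat.pow_le_pow_left ?_ _)
          have : b ≤ a := by rw [ha]; nlinarith
          omega
        have h6 : ((N + 2) * a) ^ N = b ^ (N + 1) := by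
          rw [ha, mul_pow, mul_pow, ← mul_assoc, ← hb]; ring
        have h7 := h5.trans (h3.trans (Nat.pow_le_pow_left h4 N))
        rw [h6] at h7
        have := Nat.pow_lt_pow_left (Nat.lt_succ_self b) (Nat.succ_ne_zero N)
        exact absurd h7 (not_le.2 this)
      · intro i j h
        funext s
        exact Fin.ext (by simpa using congrArg (fun g => g s) h)
end

section
set_option linter.unusedSectionVars false

theorem dep_poly {κ L : Type*} [Field κ] [Field L] [Algebra κ L] (Y : Submodule κ L)
    [Module.Finite κ Y] {ι : Type*} [Fintype ι] (b : ι → Polynomial L)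
    (hb : ∀ i n, (b i).coeff n ∈ Y) (hcard : Module.finrank κ Y < Fintype.card ι) :
    ∃ p : ι → Polynomial κ, p ≠ 0 ∧ ∑ i, (p i).map (algebraMap κ L) * b i = 0 := by
  classical
  let y := Module.finBasis κ Y
  let B : ι → (Fin (Module.finrank κ Y) → Polynomial κ) := fun i j =>
    ∑ n ∈ Finset.range ((b i).natDegree + 1), Polynomial.monomial n (y.repr ⟨(b i).coeff n, hb i n⟩ j)
  have hBc : ∀ i j n, (B i j).coeff n = y.repr ⟨(b i).coeff n, hb i n⟩ j := by
    intro i j n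
    simp only [B, Polynomial.finsetSum_coeff, Polynomial.coeff_monomial]
    rw [Finset.sum_ite_eq']
    split_ifs with h
    · rfl
    · have h0 : (b i).coeff n = 0 := Polynomial.coeff_eq_zero_of_natDegree_lt (by simpa using h)
      have : (⟨(b i).coeff n, hb i n⟩ : Y) = 0 := Subtype.ext h0
      rw [this]; simp
  have hbB : ∀ i, b i = ∑ j, (B i j).map (algebraMap κ L) * Polynomial.C (y j : L) := by
    intro i
    ext n
    simp only [Polynomial.finsetSum_coeff, Polynomial.coeff_mul_C, Polynomial.coeff_map, hBc]
    have := congrArg (Submodule.subtype Y) (y.sum_repr ⟨(b i).coeff n, hb i n⟩)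
    rw [map_sum] at this
    simp only [map_smul, Submodule.subtype_apply] at this
    refine this.symm.trans ?_
    refine Finset.sum_congr rfl fun j _ => ?_
    rw [Algebra.smul_def]
  have hdep : ¬ LinearIndependent (Polynomial κ) B := by
    intro h
    have := h.fintype_card_le_finrank
    simp at this
    omega
  rw [Fintype.not_linearIndependent_iff] at hdep
  obtain ⟨p, hp, i, hi⟩ := hdep
  refine ⟨p, fun h => hi (congrFun h i), ?_⟩
  have h1 : ∀ i, (p i).map (algebraMap κ L) * b i =
      ∑ j, (p i * B i j).map (algebraMap κ L) * Polynomial.C (y j : L) := by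
    intro i
    conv_lhs => rw [hbB i]
    rw [Finset.mul_sum]
    refine Finset.sum_congr rfl fun j _ => ?_
    rw [Polynomial.map_mul]; ring
  simp only [h1]
  rw [Finset.sum_comm]
  refine Finset.sum_eq_zero fun j _ => ?_
  rw [← Finset.sum_mul, ← Polynomial.map_sum]
  have := congrFun hp j
  simp only [Finset.sum_apply, Pi.smul_apply, smul_eq_mul, Pi.zero_apply] at this
  rw [this]; simp

theorem PD {B : Type*} [CommRing B] [IsDomain B] (𝔭 : Ideal (Polynomial B))
    (h0 : ∀ b : B, Polynomial.C b ∈ 𝔭 → b = 0) (R : Polynomial B) (hR : Prime R) (hR𝔭 : R ∈ 𝔭)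
    (S : Polynomial B) (hS : S ∈ 𝔭) : R ∣ S := by
  classical
  have hdeg : ∀ g ∈ 𝔭, g ≠ 0 → 0 < g.natDegree := by
    intro g hg hne
    by_contra h
    have h1 := Polynomial.eq_C_of_natDegree_eq_zero (Nat.eq_zero_of_not_pos h)
    rw [h1] at hg
    exact hne (by rw [h1, h0 _ hg, Polynomial.C_0])
  have hex : ∃ n, ∃ g ∈ 𝔭, g ≠ 0 ∧ g.natDegree = n := ⟨_, R, hR𝔭, hR.ne_zero, rfl⟩
  obtain ⟨g, hg, hne, hgn⟩ := Nat.find_spec hex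
  have hmin : ∀ r ∈ 𝔭, r.natDegree < g.natDegree → r = 0 := by
    intro r hr hlt
    by_contra hr0
    rw [hgn] at hlt
    exact Nat.find_min hex hlt ⟨r, hr, hr0, rfl⟩
  have hg0 := hdeg g hg hne
  have hlc : ¬ R ∣ Polynomial.C g.leadingCoeff := by
    intro h
    have := h0 _ (𝔭.mem_of_dvd h hR𝔭)
    exact hne (Polynomial.leadingCoeff_eq_zero.1 this)
  have hdvd : ∀ S ∈ 𝔭, ∃ a q, Polynomial.C (g.leadingCoeff ^ a) * S = q * g := by
    intro S hS
    obtain ⟨a, q, r, h1, h2⟩ := pdiv g hg0 _ S le_rfl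
    have hr : r ∈ 𝔭 := by
      have : r = Polynomial.C (g.leadingCoeff ^ a) * S - q * g := by rw [h1]; ring
      rw [this]
      exact 𝔭.sub_mem (𝔭.mul_mem_left _ hS) (𝔭.mul_mem_left _ hg)
    rw [hmin r hr h2, add_zero] at h1
    exact ⟨a, q, h1⟩
  have hRg : R ∣ g := by
    obtain ⟨a, q, h1⟩ := hdvd R hR𝔭
    rcases hR.dvd_or_dvd (⟨Polynomial.C (g.leadingCoeff ^ a), by rw [← h1]; ring⟩ : R ∣ q * g) with h | h
    · obtain ⟨q', rfl⟩ := h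
      have h2 : Polynomial.C (g.leadingCoeff ^ a) = q' * g := by
        apply mul_right_cancel₀ hR.ne_zero
        rw [h1]; ring
      have h3 : Polynomial.C (g.leadingCoeff ^ a) ∈ 𝔭 := by rw [h2]; exact 𝔭.mul_mem_left _ hg
      exact absurd (h0 _ h3) (pow_ne_zero _ (Polynomial.leadingCoeff_ne_zero.2 hne))
    · exact h
  obtain ⟨a, q, h1⟩ := hdvd S hS
  have h2 : R ∣ Polynomial.C (g.leadingCoeff ^ a) * S := by rw [h1]; exact hRg.mul_left q
  rcases hR.dvd_or_dvd h2 with h | h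
  · rw [Polynomial.C_pow] at h
    exact absurd (hR.dvd_of_dvd_pow h) hlc
  · exact h

theorem rootMult_le {F L : Type*} [Field F] [CharZero F] [Field L] [Algebra F L] (θ : L)
    (hθ : IsIntegral F θ) (e : ℕ) : ∀ (p : Polynomial F), p ≠ 0 →
    p.natDegree ≤ (minpoly F θ).natDegree * e →
    (p.map (algebraMap F L)).rootMultiplicity θ ≤ e := by
  classical
  have hqd : 0 < (minpoly F θ).natDegree := minpoly.natDegree_pos hθ
  induction e with
  | zero =>
    intro p hp hdeg
    rw [mul_zero, Nat.le_zero] at hdeg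
    obtain ⟨a, rfl⟩ := Polynomial.natDegree_eq_zero.1 hdeg
    simp
  | succ e ih =>
    intro p hp hdeg
    by_cases hr : (p.map (algebraMap F L)).IsRoot θ
    · have h1 : minpoly F θ ∣ p := minpoly.dvd F θ (by
        rwa [Polynomial.IsRoot, Polynomial.eval_map_algebraMap] at hr)
      obtain ⟨p', rfl⟩ := h1
      have hp' : p' ≠ 0 := right_ne_zero_of_mul hp
      have hq' := left_ne_zero_of_mul hp
      rw [Polynomial.natDegree_mul hq' hp'] at hdeg
      have h2 := ih p' hp' (by rw [mul_add] at hdeg; omega)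
      rw [Polynomial.map_mul, Polynomial.rootMultiplicity_mul
        (mul_ne_zero (by simpa using hq') (by simpa using hp'))]
      have h3 : ((minpoly F θ).map (algebraMap F L)).rootMultiplicity θ ≤ 1 := by
        apply Polynomial.rootMultiplicity_le_one_of_separable
        exact (minpoly.irreducible hθ).separable.map
      omega
    · rw [Polynomial.rootMultiplicity_eq_zero hr]; omega
end

section
set_option linter.unusedSectionVars false
variable {k : Type*} [Field k] {L : Type*} [Field L] [Algebra k L]

theorem aeval_mem_sub {σ : Type*} (K : Subalgebra k L) (x : σ → L) (f : MvPolynomial σ k)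
    (h : ∀ i ∈ f.vars, x i ∈ K) : aeval x f ∈ K := by
  rw [aeval_def, eval₂_eq]
  refine sum_mem fun m hm => mul_mem (K.algebraMap_mem _) (prod_mem fun i hi => pow_mem (h i ?_) _)
  rw [mem_vars_iff_mem_support]; exact ⟨m, hm, hi⟩

theorem primEl [Infinite k] {F : Type*} [Field F] [CharZero F] [Algebra k F] [Algebra F L] [IsScalarTower k F L]
    {ι : Type*} [Fintype ι] (y : ι → L) (hy : ∀ i, IsIntegral F (y i)) :
    ∃ c : ι → k, ∀ i, y i ∈ IntermediateField.adjoin F {∑ i, c i • y i} := by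
  classical
  let M := IntermediateField.adjoin F (Set.range y)
  have hfd : FiniteDimensional F M :=
    IntermediateField.finiteDimensional_adjoin (by rintro _ ⟨i, rfl⟩; exact hy i)
  have hfin : Finite (IntermediateField F M) :=
    Field.finite_intermediateField_of_exists_primitive_element F M (Field.exists_primitive_element F M)
  let y' : ι → M := fun i => ⟨y i, IntermediateField.subset_adjoin F _ ⟨i, rfl⟩⟩
  let Λ : (ι → k) →ₗ[k] M := Fintype.linearCombination k y'
  let V : IntermediateField F M → Submodule k (ι → k) := fun E =>
    ((Subalgebra.toSubmodule E.toSubalgebra).restrictScalars k).comap Λ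
  have hV : ∀ E : IntermediateField F M, (∀ i, y' i ∈ E) → E = ⊤ := by
    intro E hE
    have h1 : M ≤ E.map M.val := by
      apply IntermediateField.adjoin_le_iff.2
      rintro _ ⟨i, rfl⟩
      exact ⟨y' i, hE i, rfl⟩
    rw [eq_top_iff]
    rintro ⟨z, hz⟩ -
    obtain ⟨w, hw, hw'⟩ := h1 hz
    have : w = ⟨z, hz⟩ := Subtype.ext hw'
    rwa [← this]
  have hVtop : ∀ E, V E = ⊤ → E = ⊤ := by
    intro E hE
    apply hV
    intro i
    have : Pi.single i (1 : k) ∈ V E := by rw [hE]; trivial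
    simpa [V, Λ, Fintype.linearCombination_apply_single] using this
  have hne : ∃ c : ι → k, ∀ E, E ≠ ⊤ → c ∉ V E := by
    by_contra! hcon
    have := Fintype.ofFinite (IntermediateField F M)
    refine Subspace.biUnion_ne_univ_of_top_notMem (k := k) (E := ι → k)
      (s := (Finset.univ.filter (fun E : IntermediateField F M => E ≠ ⊤)).image V) ?_ ?_
    · intro h
      obtain ⟨E, hE, hE'⟩ := Finset.mem_image.1 h
      exact (Finset.mem_filter.1 hE).2 (hVtop E hE')
    · rw [Set.eq_univ_iff_forall]
      intro c
      obtain ⟨E, hE, hc⟩ := hcon c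
      simp only [Set.mem_iUnion]
      exact ⟨V E, Finset.mem_image.2 ⟨E, by simpa using hE, rfl⟩, hc⟩
  obtain ⟨c, hc⟩ := hne
  refine ⟨c, fun i => ?_⟩
  have htop : IntermediateField.adjoin F {Λ c} = ⊤ := by
    by_contra h
    exact hc _ h (IntermediateField.subset_adjoin F _ (Set.mem_singleton _))
  have h1 : y' i ∈ IntermediateField.adjoin F {Λ c} := by rw [htop]; trivial
  have h2 : M.val (y' i) ∈ (IntermediateField.adjoin F {Λ c}).map M.val := ⟨_, h1, rfl⟩
  rw [IntermediateField.adjoin_map, Set.image_singleton] at h2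
  have h3 : M.val (Λ c) = ∑ i, c i • y i := by
    simp only [Λ, Fintype.linearCombination_apply]
    rw [map_sum]
    refine Finset.sum_congr rfl fun i _ => ?_
    rfl
  rw [h3] at h2
  exact h2

theorem common_den {ι κ : Type*} [Fintype κ] (y : ι → L) (a : κ → L)
    (ha : ∀ i, a i ∈ IntermediateField.adjoin k (Set.range y)) :
    ∃ (d : MvPolynomial ι k) (f : κ → MvPolynomial ι k), aeval y d ≠ 0 ∧
      ∀ i, aeval y d * a i = aeval y (f i) := by
  classical
  have h1 : ∀ i, ∃ f g : MvPolynomial ι k, aeval y g ≠ 0 ∧ aeval y g * a i = aeval y f := by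
    intro i
    obtain ⟨r, s, h⟩ := (IntermediateField.mem_adjoin_range_iff k y (a i)).1 (ha i)
    by_cases hs : aeval y s = 0
    · refine ⟨0, 1, by simp, ?_⟩
      rw [h, hs]; simp
    · exact ⟨r, s, hs, by rw [h]; field_simp⟩
  choose f g hg hfg using h1
  refine ⟨∏ i, g i, fun i => f i * ∏ j ∈ Finset.univ.erase i, g j, ?_, fun i => ?_⟩
  · rw [map_prod]; exact Finset.prod_ne_zero_iff.2 fun i _ => hg i
  · rw [map_mul, ← hfg, ← Finset.mul_prod_erase _ _ (Finset.mem_univ i), map_mul]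
    ring

variable {σ : Type*} [LinearOrder σ]

theorem alg_over [Fintype σ] (P : Ideal (MvPolynomial σ k)) (x : σ → L)
    (hx : ∀ f, aeval x f = 0 ↔ f ∈ P) (s : σ) (hs : ¬ FreeAt P s) (F : IntermediateField k L)
    (hF : ∀ u, FreeAt P u → u < s → x u ∈ F) :
    ∀ i ≤ s, IsAlgebraic F (x i) := by
  intro i
  induction i using WellFoundedLT.induction with
  | ind i ih =>
  intro hi
  by_cases hfree : FreeAt P i
  · have hlt : i < s := lt_of_le_of_ne hi (by rintro rfl; exact hs hfree)
    exact isAlgebraic_algebraMap (⟨x i, hF i hfree hlt⟩ : F)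
  · rw [FreeAt] at hfree
    push Not at hfree
    obtain ⟨p, hp, j, hj⟩ := hfree
    let E := algebraicClosure F L
    have hmem : ∀ f : supported k (Set.Iio i), aeval x (f : MvPolynomial σ k) ∈ E := by
      intro f
      have := aeval_mem_sub (E.toSubalgebra.restrictScalars k) x (f : MvPolynomial σ k) (by
        intro t ht
        have h1 : t < i := mem_supported.1 f.2 ht
        exact (mem_algebraicClosure_iff (F := F)).2 (ih t h1 (h1.le.trans hi)))
      exact this
    let ξ : supported k (Set.Iio i) →ₐ[k] L := (aeval x).comp (Subalgebra.val _)
    let ξE : supported k (Set.Iio i) →+* E := ξ.toRingHom.codRestrict E.toSubfield (fun f => hmem f)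
    have h2 : IsAlgebraic E (x i) := by
      refine ⟨p.map ξE, ?_, ?_⟩
      · intro h
        have h3 := congrArg (fun q => Polynomial.coeff q j) h
        simp only [Polynomial.coeff_map, Polynomial.coeff_zero] at h3
        have h4 := congrArg (fun z : E => (z : L)) h3
        exact hj ((hx _).1 h4)
      · have h5 := (hx _).2 hp
        change (aeval x : MvPolynomial σ k →ₐ[k] L).toRingHom _ = 0 at h5
        rw [Polynomial.aeval_def, Polynomial.hom_eval₂] at h5
        change Polynomial.eval₂ _ (aeval x (X i)) p = 0 at h5
        rw [Polynomial.aeval_def, Polynomial.eval₂_map]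
        rw [aeval_X] at h5
        exact h5
    exact h2.restrictScalars_of_isIntegral F
end

section
set_option linter.unusedSectionVars false

theorem opteval {Λ U C' : Type*} [CommRing Λ] [CommRing C'] (ψ : Λ →+* C') (t : C') (z : U → C')
    (R : MvPolynomial (Option U) Λ) :
    eval₂Hom ψ (fun o => o.elim t z) R =
      Polynomial.eval₂ (eval₂Hom ψ z) t (optionEquivLeft Λ U R) := by
  have : eval₂Hom ψ (fun o => Option.elim o t z) =
    (Polynomial.eval₂RingHom (eval₂Hom ψ z) t).comp (optionEquivLeft Λ U : MvPolynomial (Option U) Λ →+* _) := by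
    apply MvPolynomial.ringHom_ext
    · intro r; simp [optionEquivLeft_C]
    · rintro (_ | u) <;> simp [optionEquivLeft_X_none, optionEquivLeft_X_some]
  rw [this]; rfl

variable {k : Type*} [Field k] {L : Type*} [Field L] [Algebra k L]

noncomputable def coefn {ι : Type*} (n : ℕ) (b : MvPolynomial ι (Polynomial k)) : MvPolynomial ι k :=
  ∑ α ∈ b.support, monomial α ((b.coeff α).coeff n)

theorem coeff_coefn {ι : Type*} (n : ℕ) (b : MvPolynomial ι (Polynomial k)) (α : ι →₀ ℕ) :
    (coefn n b).coeff α = (b.coeff α).coeff n := by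
  classical
  simp only [coefn, coeff_sum, coeff_monomial]
  rw [Finset.sum_ite_eq']
  split_ifs with h
  · rfl
  · rw [notMem_support_iff.1 h]; simp

theorem coeff_ev {ι A : Type*} [CommRing A] [Algebra k A] (w : ι → A) (b : MvPolynomial ι (Polynomial k)) (n : ℕ) :
    (eval₂Hom (Polynomial.mapRingHom (algebraMap k A)) (fun i => Polynomial.C (w i)) b).coeff n =
      aeval w (coefn n b) := by
  rw [coe_eval₂Hom, eval₂_eq, Polynomial.finsetSum_coeff, coefn, map_sum]
  refine Finset.sum_congr rfl fun α _ => ?_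
  have : ∏ i ∈ α.support, (Polynomial.C (w i)) ^ α i = Polynomial.C (∏ i ∈ α.support, w i ^ α i) := by
    rw [map_prod]; simp
  rw [this, Polynomial.coeff_mul_C, aeval_monomial]
  simp [Finsupp.prod]

theorem ev_inj {ι : Type*} (w : ι → L) (hw : ∀ f : MvPolynomial ι k, aeval w f = 0 → f = 0)
    (b : MvPolynomial ι (Polynomial k))
    (hb : eval₂Hom (Polynomial.mapRingHom (algebraMap k L)) (fun i => Polynomial.C (w i)) b = 0) :
    b = 0 := by
  ext α n
  rw [← coeff_coefn, hw (coefn n b)]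
  · simp
  · rw [← coeff_ev, hb]; simp

def BD {σ : Type*} (d : ℕ) (q : Polynomial (MvPolynomial σ k)) : Prop := ∀ n, (q.coeff n).totalDegree ≤ d

theorem BD.mul {σ : Type*} {d e : ℕ} {p q : Polynomial (MvPolynomial σ k)} (hp : BD d p) (hq : BD e q) :
    BD (d + e) (p * q) := by
  intro n
  rw [Polynomial.coeff_mul]
  refine totalDegree_finsetSum_le fun i _ => ?_
  exact (totalDegree_mul _ _).trans (add_le_add (hp _) (hq _))

theorem BD.one {σ : Type*} : BD 0 (1 : Polynomial (MvPolynomial σ k)) := by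
  intro n
  rw [Polynomial.coeff_one]
  split_ifs <;> simp

theorem BD.pow {σ : Type*} {p : Polynomial (MvPolynomial σ k)} (hp : BD 1 p) (m : ℕ) :
    BD m (p ^ m) := by
  induction m with
  | zero => rw [pow_zero]; exact BD.one
  | succ m ih => rw [pow_succ]; exact ih.mul hp

theorem BD.prod {σ ι : Type*} (v : ι → Polynomial (MvPolynomial σ k)) (hv : ∀ o, BD 1 (v o)) (α : ι → ℕ)
    (s : Finset ι) : BD (∑ i ∈ s, α i) (∏ i ∈ s, v i ^ α i) := by
  classical
  induction s using Finset.induction_on with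
  | empty => simpa using BD.one
  | insert a s ha ih =>
    rw [Finset.sum_insert ha, Finset.prod_insert ha]
    exact ((hv a).pow _).mul ih

theorem BD.eval {σ ι : Type*} (v : ι → Polynomial (MvPolynomial σ k)) (hv : ∀ o, BD 1 (v o))
    (D : ℕ) (R : MvPolynomial ι (Polynomial k)) (hR : R.totalDegree ≤ D) :
    BD D (eval₂Hom (Polynomial.mapRingHom (algebraMap k (MvPolynomial σ k))) v R) := by
  intro n
  rw [coe_eval₂Hom, eval₂_eq, Polynomial.finsetSum_coeff]
  refine totalDegree_finsetSum_le fun α hα => ?_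
  have h1 : BD 0 (Polynomial.mapRingHom (algebraMap k (MvPolynomial σ k)) (R.coeff α)) := by
    intro n; simp [algebraMap_eq]
  have := h1.mul (BD.prod v hv α α.support) n
  refine this.trans ?_
  rw [zero_add]
  exact (le_totalDegree hα).trans hR

/-- From a polynomial `Q` in `Z` and `lam` over `A`, extract the coefficient of `lam^μ` in `Q(lam, lam * Y)`. -/
noncomputable def diagP {A : Type*} [CommRing A] (μ : ℕ) (Q : Polynomial (Polynomial A)) : Polynomial A :=
  ∑ i ∈ Finset.range (μ + 1), Polynomial.monomial i ((Q.coeff i).coeff (μ - i))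

theorem coeff_diagP {A : Type*} [CommRing A] (μ : ℕ) (Q : Polynomial (Polynomial A)) (i : ℕ) :
    (diagP μ Q).coeff i = if i ≤ μ then (Q.coeff i).coeff (μ - i) else 0 := by
  classical
  simp only [diagP, Polynomial.finsetSum_coeff, Polynomial.coeff_monomial]
  rw [Finset.sum_ite_eq']
  simp [Nat.lt_succ_iff]

theorem natDegree_diagP {A : Type*} [CommRing A] (μ : ℕ) (Q : Polynomial (Polynomial A)) :
    (diagP μ Q).natDegree ≤ μ := by
  rw [Polynomial.natDegree_le_iff_coeff_eq_zero]
  intro i hi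
  rw [coeff_diagP, if_neg (by omega)]

theorem aeval_diagP {A B : Type*} [CommRing A] [CommRing B] [Algebra A B] (μ : ℕ) (Q : Polynomial (Polynomial A))
    (z : B) :
    (Polynomial.eval₂ (Polynomial.mapRingHom (algebraMap A B)) (Polynomial.X * Polynomial.C z) Q).coeff μ =
      Polynomial.aeval z (diagP μ Q) := by
  classical
  rw [Polynomial.eval₂_eq_sum_range, Polynomial.finsetSum_coeff]
  have h1 : ∀ i, (Polynomial.mapRingHom (algebraMap A B) (Q.coeff i) *
      (Polynomial.X * Polynomial.C z) ^ i).coeff μ =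
      if i ≤ μ then algebraMap A B ((Q.coeff i).coeff (μ - i)) * z ^ i else 0 := by
    intro i
    rw [mul_pow, ← mul_assoc, ← Polynomial.C_pow, Polynomial.coeff_mul_C, Polynomial.coeff_mul_X_pow']
    split_ifs <;> simp
  simp only [h1]
  rw [diagP, map_sum]
  simp only [Polynomial.aeval_monomial]
  rw [← Finset.sum_filter]
  have h2 : ∀ i, Q.natDegree < i → algebraMap A B ((Q.coeff i).coeff (μ - i)) * z ^ i = 0 := by
    intro i hi
    rw [Polynomial.coeff_eq_zero_of_natDegree_lt hi]; simp
  refine Finset.sum_subset_zero_on_sdiff ?_ ?_ (fun _ _ => rfl)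
  · intro i hi
    simp only [Finset.mem_filter, Finset.mem_range] at hi ⊢
    omega
  · intro i hi
    simp only [Finset.mem_sdiff, Finset.mem_filter, Finset.mem_range] at hi
    exact h2 i (by omega)
end

section
set_option linter.unusedSectionVars false
variable {k : Type*} [Field k] {L : Type*} [Field L] [Algebra k L]

theorem exists_R {σ ι : Type*} [Fintype σ] (v : ι → Polynomial (MvPolynomial σ k)) (hv : ∀ o, BD 1 (v o))
    (x : σ → L) (D : ℕ) (𝓑 : Finset (ι →₀ ℕ)) (h𝓑 : ∀ β ∈ 𝓑, β.degree ≤ D)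
    (hcard : Module.finrank k (Wsp (k := k) x D) < 𝓑.card)
    (Ψ : MvPolynomial ι (Polynomial k) →+* Polynomial L)
    (hΨ : Ψ = eval₂Hom (Polynomial.mapRingHom (algebraMap k L))
      (fun o => (v o).map (aeval x : MvPolynomial σ k →ₐ[k] L).toRingHom)) :
    ∃ R : MvPolynomial ι (Polynomial k), Prime R ∧ R.totalDegree ≤ D ∧ Ψ R = 0 := by
  classical
  have hΨ' : Ψ = (Polynomial.mapRingHom (aeval x : MvPolynomial σ k →ₐ[k] L).toRingHom).comp
      (eval₂Hom (Polynomial.mapRingHom (algebraMap k (MvPolynomial σ k))) v) := by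
    rw [hΨ]
    apply MvPolynomial.ringHom_ext
    · intro r
      simp only [eval₂Hom_C, RingHom.comp_apply, Polynomial.coe_mapRingHom, Polynomial.map_map]
      congr 1
      ext a; simp [algebraMap_eq]
    · intro i; simp
  have := (finrank_restrict (k := k) (σ := σ) D).1
  have hfin : Module.Finite k (Wsp (k := k) x D) := by
    unfold Wsp; infer_instance
  obtain ⟨p, hp, hp0⟩ := dep_poly (Wsp (k := k) x D) (fun β : 𝓑 => Ψ (monomial (β : ι →₀ ℕ) 1)) (by
    intro β n
    rw [hΨ', RingHom.comp_apply, Polynomial.coe_mapRingHom, Polynomial.coeff_map]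
    refine ⟨_, ?_, rfl⟩
    rw [SetLike.mem_coe, mem_restrictTotalDegree]
    apply BD.eval v hv
    refine (totalDegree_monomial_le _ _).trans ?_
    exact h𝓑 _ β.2) (by simpa using hcard)
  let R0 : MvPolynomial ι (Polynomial k) := ∑ β : 𝓑, monomial (β : ι →₀ ℕ) (p β)
  have hR0 : Ψ R0 = 0 := by
    rw [← hp0]
    simp only [R0, map_sum]
    refine Finset.sum_congr rfl fun β _ => ?_
    have h1 : monomial (β : ι →₀ ℕ) (p β) = C (p β) * monomial (β : ι →₀ ℕ) 1 := by
      rw [C_mul_monomial, mul_one]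
    rw [h1, map_mul]
    congr 1
    rw [hΨ, eval₂Hom_C]; rfl
  have hR0c : ∀ β : 𝓑, R0.coeff β = p β := by
    intro β
    simp only [R0, coeff_sum, coeff_monomial, Subtype.coe_inj]
    simp
  have hR0ne : R0 ≠ 0 := by
    intro h
    apply hp
    funext β
    rw [← hR0c, h]; simp
  have hR0d : R0.totalDegree ≤ D := by
    refine totalDegree_finsetSum_le fun β _ => ?_
    exact (totalDegree_monomial_le _ _).trans (h𝓑 _ β.2)
  have hprime : (RingHom.ker Ψ).IsPrime := RingHom.ker_isPrime _
  obtain ⟨fs, hfs, hassoc⟩ := UniqueFactorizationMonoid.exists_prime_factors R0 hR0ne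
  have hmem : fs.prod ∈ RingHom.ker Ψ := by
    obtain ⟨u, hu⟩ := hassoc.symm
    rw [← hu] 
    exact Ideal.mul_mem_right _ _ hR0
  obtain ⟨R, hR, hRk⟩ := (Ideal.IsPrime.multiset_prod_mem_iff_exists_mem hprime fs).1 hmem
  refine ⟨R, hfs R hR, ?_, hRk⟩
  refine (totalDegree_le_of_dvd_of_isDomain ?_ hR0ne).trans hR0d
  exact (Multiset.dvd_prod hR).trans hassoc.dvd

theorem exists_S {U : Type*} (V : Set U) (y : U → L) (F0 : IntermediateField k L)
    (hF0 : F0 = IntermediateField.adjoin k (Set.range fun v : V => y v)) (Y : Submodule F0 L)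
    [Module.Finite F0 Y] (Θ : Polynomial L) (w : ℕ) (hΘ : ∀ j n, (Θ ^ j).coeff n ∈ Y)
    (hw : Module.finrank F0 Y ≤ w) :
    ∃ b : Fin (w + 1) → MvPolynomial U (Polynomial k), b ≠ 0 ∧
      (∀ j, b j ∈ supported (Polynomial k) V) ∧
      ∑ j, eval₂Hom (Polynomial.mapRingHom (algebraMap k L)) (fun i => Polynomial.C (y i)) (b j) *
        Θ ^ (j : ℕ) = 0 := by
  classical
  obtain ⟨p, hp, hp0⟩ := dep_poly Y (fun j : Fin (w + 1) => Θ ^ (j : ℕ)) (fun j n => hΘ j n) (by simp; omega)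
  let m := Finset.univ.sup (fun j => (p j).natDegree)
  obtain ⟨d, f, hd, hf⟩ := common_den (k := k) (fun v : V => y v)
    (fun q : Fin (w + 1) × Fin (m + 1) => ((p q.1).coeff q.2 : L)) (fun q => by
      rw [← hF0]; exact ((p q.1).coeff q.2).2)
  let b : Fin (w + 1) → MvPolynomial U (Polynomial k) := fun j =>
    ∑ i : Fin (m + 1), C (Polynomial.X ^ (i : ℕ)) * MvPolynomial.map Polynomial.C (rename Subtype.val (f (j, i)))
  let dd := aeval (fun v : V => y v) d
  have hev : ∀ g : MvPolynomial U k, eval₂Hom (Polynomial.mapRingHom (algebraMap k L))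
      (fun i => Polynomial.C (y i)) (MvPolynomial.map Polynomial.C g) = Polynomial.C (aeval y g) := by
    intro g
    rw [coe_eval₂Hom, eval₂_map, aeval_def, eval₂_comp_left]
    congr 1
    ext a; simp
  have hb : ∀ j, eval₂Hom (Polynomial.mapRingHom (algebraMap k L)) (fun i => Polynomial.C (y i)) (b j) =
      Polynomial.C dd * (p j).map (algebraMap F0 L) := by
    intro j
    have h1 : (p j).map (algebraMap F0 L) = ∑ i : Fin (m + 1), Polynomial.C ((p j).coeff i : L) * Polynomial.X ^ (i : ℕ) := by
      have hlt : ((p j).map (algebraMap F0 L)).natDegree < m + 1 := by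
        rw [Polynomial.natDegree_map]
        exact Nat.lt_succ_of_le (Finset.le_sup (f := fun j => (p j).natDegree) (Finset.mem_univ j))
      conv_lhs => rw [Polynomial.as_sum_range_C_mul_X_pow' _ hlt]
      rw [Finset.sum_range]
      refine Finset.sum_congr rfl fun i _ => ?_
      rw [Polynomial.coeff_map]; rfl
    rw [h1, Finset.mul_sum]
    simp only [b, map_sum]
    refine Finset.sum_congr rfl fun i _ => ?_
    rw [map_mul, hev, eval₂Hom_C, aeval_rename]
    have h2 := hf (j, i)
    simp only at h2
    rw [← mul_assoc, ← Polynomial.C_mul, h2, mul_comm]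
    simp [Function.comp_def]
  refine ⟨b, ?_, ?_, ?_⟩
  · intro h
    apply hp
    funext j
    have h1 := hb j
    rw [h, Pi.zero_apply, map_zero] at h1
    have h2 := (mul_eq_zero.1 h1.symm).resolve_left (by simpa using hd)
    rwa [Polynomial.map_eq_zero] at h2
  · intro j
    refine sum_mem fun i _ => mul_mem (Subalgebra.algebraMap_mem _ _) ?_
    rw [mem_supported]
    intro u hu
    have h1 := vars_map _ _ hu
    have h2 := vars_rename _ _ h1
    obtain ⟨z, _, rfl⟩ := Finset.mem_image.1 h2
    exact z.2
  · have h1 : ∀ j : Fin (w + 1), eval₂Hom (Polynomial.mapRingHom (algebraMap k L)) (fun i => Polynomial.C (y i)) (b j) * Θ ^ (j : ℕ) =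
      Polynomial.C dd * ((p j).map (algebraMap F0 L) * Θ ^ (j : ℕ)) := by
      intro j; rw [hb]; ring
    simp only [h1]
    rw [← Finset.mul_sum, hp0, mul_zero]

theorem deg_vars {ι Λ : Type*} [CommRing Λ] (f : MvPolynomial ι Λ) (i : ι) :
    f.degreeOf i = 0 ↔ i ∉ f.vars := by
  classical
  rw [degreeOf_def, vars_def, Multiset.mem_toFinset, Multiset.count_eq_zero]

theorem opt_rename_some {U Λ : Type*} [CommRing Λ] (b : MvPolynomial U Λ) :
    optionEquivLeft Λ U (rename some b) = Polynomial.C b := by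
  have : ((optionEquivLeft Λ U : MvPolynomial (Option U) Λ →ₐ[Λ] _).comp (rename some)) =
      IsScalarTower.toAlgHom Λ (MvPolynomial U Λ) (Polynomial (MvPolynomial U Λ)) := by
    apply algHom_ext
    intro i
    simp [optionEquivLeft_X_some]
  exact congrArg (fun φ => φ b) this

theorem R_props {U : Type*} (V : Set U) (y : U → L)
    (hy : ∀ f : MvPolynomial U k, aeval y f = 0 → f = 0)
    (Θ : Polynomial L) (w : ℕ)
    (b : Fin (w + 1) → MvPolynomial U (Polynomial k)) (hb : b ≠ 0)
    (hbV : ∀ j, b j ∈ supported (Polynomial k) V)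
    (hb0 : ∑ j, eval₂Hom (Polynomial.mapRingHom (algebraMap k L)) (fun i => Polynomial.C (y i)) (b j) *
        Θ ^ (j : ℕ) = 0)
    (R : MvPolynomial (Option U) (Polynomial k)) (hR : Prime R)
    (hR0 : eval₂Hom (Polynomial.mapRingHom (algebraMap k L))
      (fun o => o.elim Θ (fun i => Polynomial.C (y i))) R = 0) :
    (∀ u, some u ∈ R.vars → u ∈ V) ∧ (optionEquivLeft _ U R).natDegree ≤ w ∧
    ((optionEquivLeft _ U R).map ((Polynomial.constantCoeff (R := L)).comp
      (eval₂Hom (Polynomial.mapRingHom (algebraMap k L)) (fun i => Polynomial.C (y i))))) ≠ 0 := by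
  classical
  set ev := eval₂Hom (Polynomial.mapRingHom (algebraMap k L)) (fun i => Polynomial.C (y i)) with hev
  have hevinj : ∀ b, ev b = 0 → b = 0 := ev_inj y hy
  set R' := optionEquivLeft (Polynomial k) U R with hR'
  have hR'p : Prime R' := by
    rw [hR']
    exact (MulEquiv.prime_iff (optionEquivLeft (Polynomial k) U)).2 hR
  rw [opteval] at hR0
  let 𝔭 := RingHom.ker (Polynomial.eval₂RingHom ev Θ)
  have hR'𝔭 : R' ∈ 𝔭 := hR0
  have h0 : ∀ b, Polynomial.C b ∈ 𝔭 → b = 0 := by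
    intro b hb
    apply hevinj
    have : Polynomial.eval₂ ev Θ (Polynomial.C b) = 0 := hb
    rwa [Polynomial.eval₂_C] at this
  let S : MvPolynomial (Option U) (Polynomial k) := ∑ j, rename some (b j) * X none ^ (j : ℕ)
  have hS : optionEquivLeft (Polynomial k) U S = ∑ j, Polynomial.C (b j) * Polynomial.X ^ (j : ℕ) := by
    simp only [S, map_sum, map_mul, map_pow, opt_rename_some, optionEquivLeft_X_none]
  have hSp : optionEquivLeft (Polynomial k) U S ∈ 𝔭 := by
    change Polynomial.eval₂ ev Θ _ = 0
    rw [hS, Polynomial.eval₂_finsetSum, ← hb0]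
    refine Finset.sum_congr rfl fun j _ => ?_
    simp
  have hSne : optionEquivLeft (Polynomial k) U S ≠ 0 := by
    intro h
    apply hb
    funext j
    rw [hS] at h
    have := congrArg (fun q => Polynomial.coeff q j) h
    simp only [Polynomial.finsetSum_coeff, Polynomial.coeff_C_mul_X_pow, Polynomial.coeff_zero] at this
    rw [Finset.sum_eq_single j] at this
    · simpa using this
    · intro i _ hij
      rw [if_neg]
      exact fun h => hij (Fin.ext h.symm)
    · simp
  have hSne' : S ≠ 0 := by rintro h; apply hSne; rw [h, map_zero]
  have hdvd : R' ∣ optionEquivLeft (Polynomial k) U S := PD 𝔭 h0 R' hR'p hR'𝔭 _ hSp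
  refine ⟨?_, ?_, ?_⟩
  · intro u hu
    by_contra huV
    have hRS : R ∣ S := by
      rw [hR'] at hdvd
      exact (map_dvd_iff (optionEquivLeft (Polynomial k) U)).1 hdvd
    obtain ⟨T, hT⟩ := hRS
    have hS0 : S.degreeOf (some u) = 0 := by
      rw [deg_vars] 
      have : S ∈ supported (Polynomial k) (insert none (some '' V)) := by
        refine sum_mem fun j _ => mul_mem ?_ (pow_mem (X_mem_supported.2 (by simp)) _)
        rw [mem_supported]
        intro o ho
        obtain ⟨z, hz, rfl⟩ := Finset.mem_image.1 (vars_rename _ _ ho)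
        exact Set.mem_insert_of_mem _ ⟨z, mem_supported.1 (hbV j) hz, rfl⟩
      intro h
      have := mem_supported.1 this h
      simp at this
      exact huV this
    rw [hT, degreeOf_mul_eq (by rintro rfl; simp at hT; exact hSne' hT) (by rintro rfl; simp at hT; exact hSne' hT)] at hS0
    have : R.degreeOf (some u) = 0 := by omega
    rw [deg_vars] at this
    exact this hu
  · refine (Polynomial.natDegree_le_of_dvd hdvd hSne).trans ?_
    rw [hS]
    refine Polynomial.natDegree_sum_le_of_forall_le _ _ fun j _ => ?_
    refine (Polynomial.natDegree_C_mul_X_pow_le _ _).trans ?_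
    have := j.2; omega
  · intro hcon
    have h1 : Polynomial.C (C Polynomial.X) ∣ R' := by
      rw [Polynomial.C_dvd_iff_dvd_coeff]
      intro j
      rw [MvPolynomial.C_dvd_iff_dvd_coeff]
      intro α
      rw [Polynomial.X_dvd_iff, ← coeff_coefn, hy (coefn 0 (R'.coeff j))]
      · simp
      · rw [← coeff_ev]
        have := congrArg (fun q => Polynomial.coeff q j) hcon
        simp only [Polynomial.coeff_map, Polynomial.coeff_zero] at this
        exact this
    obtain ⟨t, ht⟩ := h1
    have hX : ev (C Polynomial.X) = Polynomial.X := by simp [hev]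
    rcases hR'p.irreducible.isUnit_or_isUnit ht with h | h
    · have h2 := h.map (Polynomial.eval₂RingHom ev Θ)
      rw [Polynomial.coe_eval₂RingHom, Polynomial.eval₂_C, hX] at h2
      exact Polynomial.not_isUnit_X h2
    · have h2 : Polynomial.C (C Polynomial.X) ∈ 𝔭 := by
        obtain ⟨t', rfl⟩ := h
        have : Polynomial.C (C Polynomial.X) = R' * ((t'⁻¹ : (Polynomial (MvPolynomial U (Polynomial k)))ˣ) : Polynomial (MvPolynomial U (Polynomial k))) := by
          rw [ht, mul_assoc, Units.mul_inv, mul_one]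
        rw [this]
        exact 𝔭.mul_mem_right _ hR'𝔭
      have h3 := h0 _ h2
      rw [h3, map_zero] at hX
      exact Polynomial.X_ne_zero hX.symm
end

section
set_option linter.unusedSectionVars false
variable {k : Type*} [Field k] {L : Type*} [Field L] [Algebra k L]

theorem field_part [CharZero k] (F0 : IntermediateField k L) {ι : Type*} [Fintype ι] (y : ι → L)
    (hy : ∀ i, IsIntegral F0 (y i)) (z : L) (hz : IsIntegral F0 z) :
    ∃ (c : ι → k) (e : ℕ), IsIntegral F0 (∑ i, c i • y i) ∧
      (∃ Y : Submodule F0 L, Module.Finite F0 Y ∧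
        Module.finrank F0 Y ≤ (minpoly F0 (∑ i, c i • y i)).natDegree * e ∧
        ∀ j n, ((Polynomial.C (∑ i, c i • y i) + Polynomial.X * Polynomial.C z) ^ j).coeff n ∈ Y) ∧
      ∃ M : IntermediateField F0 L, (∀ i, y i ∈ M) ∧
        ∀ p : Polynomial M, p ≠ 0 → Polynomial.aeval z p = 0 → e ≤ p.natDegree := by
  classical
  have : CharZero F0 := charZero_of_injective_algebraMap (algebraMap k F0).injective
  have : Infinite k := inferInstance
  obtain ⟨c, hc⟩ := primEl (k := k) (F := F0) y hy
  set θ := ∑ i, c i • y i with hθ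
  have hθi : IsIntegral F0 θ := by
    refine IsIntegral.sum _ fun i _ => ?_
    rw [← IsScalarTower.algebraMap_smul F0 (c i) (y i)]
    exact (hy i).smul _
  let M := IntermediateField.adjoin F0 {θ}
  have hfM : FiniteDimensional F0 M := IntermediateField.adjoin.finiteDimensional hθi
  have hzM : IsIntegral M z := hz.tower_top
  let E := IntermediateField.adjoin M {z}
  have hfE : FiniteDimensional M E := IntermediateField.adjoin.finiteDimensional hzM
  refine ⟨c, (minpoly M z).natDegree, hθi, ?_, M, hc, ?_⟩
  · have hfF : Module.Finite F0 E := Module.Finite.trans M E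
    have hrk : Module.finrank F0 E = (minpoly F0 θ).natDegree * (minpoly M z).natDegree := by
      rw [← IntermediateField.adjoin.finrank hθi, ← IntermediateField.adjoin.finrank hzM]
      have hfree : Module.Free M E := Module.Free.of_divisionRing M E
      have hfree' : Module.Free F0 M := Module.Free.of_divisionRing F0 M
      exact (Module.finrank_mul_finrank F0 M E).symm
    let Y : Submodule F0 L := (Subalgebra.toSubmodule E.toSubalgebra).restrictScalars F0
    refine ⟨Y, hfF, hrk.le, ?_⟩
    intro j n
    let θE : E := ⟨θ, E.algebraMap_mem (⟨θ, IntermediateField.subset_adjoin F0 _ (Set.mem_singleton _)⟩ : M)⟩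
    let zE : E := ⟨z, IntermediateField.subset_adjoin M _ (Set.mem_singleton _)⟩
    have h1 : (Polynomial.C θ + Polynomial.X * Polynomial.C z) ^ j =
        ((Polynomial.C θE + Polynomial.X * Polynomial.C zE) ^ j).map (algebraMap E L) := by
      simp [θE, zE]
    rw [h1, Polynomial.coeff_map]
    exact (((Polynomial.C θE + Polynomial.X * Polynomial.C zE) ^ j).coeff n).2
  · intro p hp hpz
    exact Polynomial.natDegree_le_natDegree (minpoly.degree_le_of_ne_zero M z hp hpz)

theorem map_ev {A B ι : Type*} [CommRing A] [CommRing B] [Algebra k A] [Algebra k B] (φ : A →ₐ[k] B)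
    (v : ι → Polynomial A) (R : MvPolynomial ι (Polynomial k)) :
    (eval₂Hom (Polynomial.mapRingHom (algebraMap k A)) v R).map (φ : A →+* B) =
      eval₂Hom (Polynomial.mapRingHom (algebraMap k B)) (fun o => (v o).map (φ : A →+* B)) R := by
  have : (Polynomial.mapRingHom (φ : A →+* B)).comp (eval₂Hom (Polynomial.mapRingHom (algebraMap k A)) v) =
      eval₂Hom (Polynomial.mapRingHom (algebraMap k B)) (fun o => (v o).map (φ : A →+* B)) := by
    apply MvPolynomial.ringHom_ext
    · intro r
      simp only [eval₂Hom_C, RingHom.comp_apply, Polynomial.coe_mapRingHom, Polynomial.map_map]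
      congr 1
      ext a; simp
    · intro i; simp
  rw [← this]; rfl

theorem map_opt {Λ U C' : Type*} [CommRing Λ] [CommRing C'] (ψ : Λ →+* C') (z z' : U → C')
    (R : MvPolynomial (Option U) Λ) (h : ∀ u, some u ∈ R.vars → z u = z' u) :
    (optionEquivLeft Λ U R).map (eval₂Hom ψ z) = (optionEquivLeft Λ U R).map (eval₂Hom ψ z') := by
  have key : ∀ z : U → C', (optionEquivLeft Λ U R).map (eval₂Hom ψ z) =
      eval₂Hom (Polynomial.C.comp ψ) (fun o => o.elim Polynomial.X (fun u => Polynomial.C (z u))) R := by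
    intro z
    rw [opteval]
    have : eval₂Hom (Polynomial.C.comp ψ) (fun u => Polynomial.C (z u)) = Polynomial.C.comp (eval₂Hom ψ z) := by
      apply MvPolynomial.ringHom_ext <;> intro i <;> simp
    rw [this]; rfl
  rw [key, key]
  apply eval₂Hom_congr' rfl _ rfl
  rintro (_ | u) h1 _
  · rfl
  · simp [h u h1]

end

section
set_option linter.unusedSectionVars false
variable {k : Type*} [Field k] {L : Type*} [Field L] [Algebra k L]
variable {σ : Type*} [LinearOrder σ]

theorem free_alg_indep [Fintype σ] (P : Ideal (MvPolynomial σ k)) [P.IsPrime] (x : σ → L)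
    (hx : ∀ f, aeval x f = 0 ↔ f ∈ P) (f : MvPolynomial {u // FreeAt P u} k)
    (hf : aeval (fun u : {u // FreeAt P u} => x u) f = 0) : f = 0 := by
  classical
  have h1 : rename Subtype.val f ∈ P := by
    rw [← hx, aeval_rename]; exact hf
  have h2 := free_indep P (Finset.univ.filter fun u => FreeAt P u) (by simp) _ h1 (by
    intro u hu
    obtain ⟨z, _, rfl⟩ := Finset.mem_image.1 (vars_rename _ _ hu)
    simpa using z.2)
  exact rename_injective _ Subtype.val_injective (by rw [h2, map_zero])

theorem lemC5 [CharZero k] [Fintype σ] (P : Ideal (MvPolynomial σ k)) [P.IsPrime] (x : σ → L)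
    (hx : ∀ f, aeval x f = 0 ↔ f ∈ P) (s : σ) (hs : ¬ FreeAt P s) (D : ℕ)
    (𝓑 : Finset (Option {u // FreeAt P u} →₀ ℕ)) (h𝓑 : ∀ β ∈ 𝓑, β.degree ≤ D)
    (hcard : Module.finrank k (Wsp (k := k) x D) < 𝓑.card) :
    ∃ g, AlgAt P D s g := by
  classical
  let U := {u // FreeAt P u}
  let y : U → L := fun u => x u
  let V : Set U := {u | (u : σ) < s}
  let F0 := IntermediateField.adjoin k (Set.range fun v : V => y v)
  have hF0 : ∀ u : U, (u : σ) < s → x u ∈ F0 := fun u hu =>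
    IntermediateField.subset_adjoin k _ ⟨⟨u, hu⟩, rfl⟩
  have hchF : CharZero F0 := charZero_of_injective_algebraMap (algebraMap k F0).injective
  have halg := alg_over P x hx s hs F0 (fun u hu hus => hF0 ⟨u, hu⟩ hus)
  have hintg : ∀ i ≤ s, IsIntegral F0 (x i) := fun i hi => (halg i hi).isIntegral
  obtain ⟨c, e, hθi, ⟨Y, hYf, hYr, hYΘ⟩, M, hM, hMe⟩ := field_part F0 (fun i : Set.Iio s => x i)
    (fun i => hintg i (le_of_lt i.2)) (x s) (hintg s le_rfl)
  set θ := ∑ i : Set.Iio s, c i • x i with hθ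
  set Θ := Polynomial.C θ + Polynomial.X * Polynomial.C (x s) with hΘ
  let w := (minpoly F0 θ).natDegree * e
  let Al := supported k (Set.Iio s)
  let Xl : Set.Iio s → Al := fun i => ⟨X (i : σ), X_mem_supported.2 i.2⟩
  let θl : Al := ∑ i, c i • Xl i
  let xu : U → Al := fun u => if h : (u : σ) < s then Xl ⟨u, h⟩ else 0
  let ξ : Al →ₐ[k] L := (aeval x).comp (Subalgebra.val _)
  have hξX : ∀ i, ξ (Xl i) = x i := by
    intro i
    change aeval x (X (i : σ)) = x i
    rw [aeval_X]
  have hξθ : ξ θl = θ := by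
    simp only [θl, map_sum, map_smul, hξX]; rfl
  have hξu : ∀ u : U, (u : σ) < s → ξ (xu u) = x u := by
    intro u hu
    simp only [xu, dif_pos hu, hξX]
  have hBDl : ∀ a : Al, (a : MvPolynomial σ k).totalDegree ≤ 1 → BD 1 (Polynomial.C (a : MvPolynomial σ k)) := by
    intro a ha n
    rw [Polynomial.coeff_C]
    split_ifs
    · exact ha
    · simp
  have hθd : (θl : MvPolynomial σ k).totalDegree ≤ 1 := by
    simp only [θl]
    rw [AddSubmonoidClass.coe_finsetSum]
    refine totalDegree_finsetSum_le fun i _ => ?_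
    change (c i • (X (i : σ) : MvPolynomial σ k)).totalDegree ≤ 1
    exact (totalDegree_smul_le _ _).trans (by simp)
  let t : Polynomial (MvPolynomial σ k) :=
    Polynomial.C (θl : MvPolynomial σ k) + Polynomial.X * Polynomial.C (X s)
  have htBD : BD 1 t := by
    intro n
    simp only [t, Polynomial.coeff_add]
    refine (totalDegree_add _ _).trans (max_le (hBDl _ hθd n) ?_)
    rw [Polynomial.coeff_mul_C, Polynomial.coeff_X]
    split_ifs <;> simp
  have htm : t.map (aeval x : MvPolynomial σ k →ₐ[k] L).toRingHom = Θ := by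
    have h1 : (aeval x : MvPolynomial σ k →ₐ[k] L) (θl : MvPolynomial σ k) = θ := hξθ
    simp [t, hΘ, h1]
  let ψ := Polynomial.mapRingHom (algebraMap k L)
  obtain ⟨R, hRp, hRd, hR0⟩ := exists_R (L := L)
    (fun o : Option U => o.elim t (fun u => Polynomial.C (X (u : σ)))) (by
      rintro (_ | u)
      · exact htBD
      · intro n
        simp only [Option.elim, Polynomial.coeff_C]
        split_ifs <;> simp) x D 𝓑 h𝓑 hcard
    (eval₂Hom ψ (fun o => o.elim Θ (fun u => Polynomial.C (y u)))) (by
      congr 1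
      funext o
      cases o with
      | none => exact htm.symm
      | some u => simp [y])
  obtain ⟨b, hb, hbV, hb0⟩ := exists_S V y F0 rfl Y Θ w hYΘ hYr
  obtain ⟨hRV, hRw, hRne⟩ := R_props V y (free_alg_indep P x hx) Θ w b hb hbV hb0 R hRp hR0
  set R' := optionEquivLeft (Polynomial k) U R with hR'
  set R0 := R'.map ((Polynomial.constantCoeff (R := L)).comp
      (eval₂Hom (Polynomial.mapRingHom (algebraMap k L)) (fun i => Polynomial.C (y i)))) with hR0def
  -- R0 as a map of eval₂Hom
  let ψ0 : Polynomial k →+* L := (Polynomial.constantCoeff (R := L)).comp ψ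
  have hR0y : R0 = R'.map (eval₂Hom ψ0 y) := by
    rw [hR0def]
    congr 1
    apply MvPolynomial.ringHom_ext
    · intro r; simp [ψ0, ψ]
    · intro i; simp
  set μ := R0.rootMultiplicity θ with hμ
  have hroot : R0.eval θ = 0 := by
    rw [opteval] at hR0
    have h1 := congrArg (Polynomial.constantCoeff (R := L)) hR0
    rw [Polynomial.hom_eval₂, map_zero] at h1
    rw [hR0def, Polynomial.eval_map, ← h1]
    congr 1
    simp [hΘ]
  have hμpos : 0 < μ := (Polynomial.rootMultiplicity_pos hRne).2 hroot
  have hμe : μ ≤ e := by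
    let xF : U → F0 := fun u => if h : (u : σ) < s then ⟨x u, hF0 u h⟩ else 0
    let ψF : Polynomial k →+* F0 := (Polynomial.constantCoeff (R := F0)).comp
      (Polynomial.mapRingHom (algebraMap k F0))
    have h1 : R0 = (R'.map (eval₂Hom ψF xF)).map (algebraMap F0 L) := by
      rw [hR0y, Polynomial.map_map, hR', map_opt ψ0 y (fun u => algebraMap F0 L (xF u))]
      · congr 1
        apply MvPolynomial.ringHom_ext
        · intro r
          simp only [eval₂Hom_C, RingHom.comp_apply, ψ0, ψF, ψ, Polynomial.constantCoeff_apply,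
            Polynomial.coe_mapRingHom, Polynomial.coeff_map]
          rfl
        · intro i; simp
      · intro u hu
        have hus : (u : σ) < s := hRV u hu
        simp only [xF, dif_pos hus]
        rfl
    rw [hμ, h1]
    apply rootMult_le θ hθi e
    · intro h
      rw [h, Polynomial.map_zero] at h1
      exact hRne h1
    · exact (Polynomial.natDegree_map_le).trans hRw
  let ω : MvPolynomial U (Polynomial k) →+* Polynomial Al :=
    eval₂Hom (Polynomial.mapRingHom (algebraMap k Al)) (fun u => Polynomial.C (xu u))
  let Q : Polynomial (Polynomial Al) := (R'.map ω).comp (Polynomial.X + Polynomial.C (Polynomial.C θl))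
  let g := diagP μ Q
  have hlead : ξ (g.coeff μ) ≠ 0 := by
    have h0 : g.coeff μ = (Q.coeff μ).coeff 0 := by simp [g, coeff_diagP]
    let κ : Polynomial Al →+* L := (ξ : Al →+* L).comp (Polynomial.constantCoeff (R := Al))
    have h1 : ξ (g.coeff μ) = (Q.map κ).coeff μ := by
      rw [h0, Polynomial.coeff_map]; rfl
    have h2 : Q.map κ = R0.comp (Polynomial.X + Polynomial.C θ) := by
      simp only [Q]
      rw [Polynomial.map_comp, Polynomial.map_map]
      congr 1
      · rw [hR0y, hR', map_opt ψ0 y (fun u => ξ (xu u))]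
        · congr 1
          apply MvPolynomial.ringHom_ext
          · intro r
            simp [κ, ω, ψ0, ψ]
          · intro i; simp [κ, ω]
        · intro u hu
          exact (hξu u (hRV u hu)).symm
      · simp [κ, hξθ]
    rw [h1, h2, hμ, Polynomial.rootMultiplicity_eq_natTrailingDegree]
    change Polynomial.trailingCoeff _ ≠ 0
    rw [Ne, Polynomial.trailingCoeff_eq_zero]
    intro h3
    apply hRne
    have h4 := congrArg (fun q => Polynomial.comp q (Polynomial.X - Polynomial.C θ)) h3
    simpa [Polynomial.comp_assoc] using h4
  have hgdeg : g.natDegree = μ := by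
    refine le_antisymm (natDegree_diagP _ _) (Polynomial.le_natDegree_of_ne_zero ?_)
    intro h; apply hlead; rw [h, map_zero]
  let v' : Option U → Polynomial (MvPolynomial σ k) :=
    fun o => o.elim t (fun u => Polynomial.C (xu u : MvPolynomial σ k))
  let N := eval₂Hom (Polynomial.mapRingHom (algebraMap k (MvPolynomial σ k))) v' R
  have hgN : Polynomial.aeval (X s : MvPolynomial σ k) g = N.coeff μ := by
    simp only [g]
    rw [← aeval_diagP]
    congr 1
    simp only [N, v']
    rw [opteval]
    simp only [Q]
    rw [Polynomial.eval₂_comp, Polynomial.eval₂_map]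
    congr 1
    · apply MvPolynomial.ringHom_ext
      · intro r
        simp only [eval₂Hom_C, RingHom.comp_apply, ω, Polynomial.coe_mapRingHom, Polynomial.map_map]
        congr 1
      · intro i
        simp [ω]
    · simp [t]
      rw [add_comm]
  refine ⟨g, ?_, ?_, ?_, ?_, ?_⟩
  · rw [hgdeg]; exact hμpos
  · rw [Polynomial.leadingCoeff, hgdeg]
    intro h
    exact hlead ((hx _).2 h)
  · rw [hgN, ← hx]
    have h1 : N.map ((aeval x : MvPolynomial σ k →ₐ[k] L) : MvPolynomial σ k →+* L) = 0 := by
      simp only [N]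
      rw [map_ev, ← hR0]
      refine eval₂Hom_congr' rfl ?_ rfl
      rintro (_ | u) hu _
      · exact htm
      · simp only [v', Option.elim, Polynomial.map_C]
        congr 1
        exact hξu u (hRV u hu)
    have h2 := congrArg (fun q => Polynomial.coeff q μ) h1
    simp only [Polynomial.coeff_map, Polynomial.coeff_zero] at h2
    exact h2
  · rw [hgN]
    apply BD.eval v' _ D R hRd
    rintro (_ | u)
    · exact htBD
    · apply hBDl
      simp only [xu]
      split_ifs
      · simp [Xl]
      · simp
  · intro p hp hpP j
    by_contra hj
    rw [hgdeg] at hp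
    have hmem : ∀ f : Al, aeval x (f : MvPolynomial σ k) ∈ M := by
      intro f
      have := aeval_mem_sub (M.toSubalgebra.restrictScalars k) x (f : MvPolynomial σ k) (by
        intro t ht
        exact hM ⟨t, mem_supported.1 f.2 ht⟩)
      exact this
    let ξM : Al →+* M := ξ.toRingHom.codRestrict M.toSubfield (fun f => hmem f)
    have h1 := hMe (p.map ξM) (by
      intro h
      have h3 := congrArg (fun q => Polynomial.coeff q j) h
      simp only [Polynomial.coeff_map, Polynomial.coeff_zero] at h3
      have h4 := congrArg (fun z : M => (z : L)) h3
      exact hj ((hx _).1 h4)) (by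
      have h5 := (hx _).2 hpP
      change (aeval x : MvPolynomial σ k →ₐ[k] L).toRingHom _ = 0 at h5
      rw [Polynomial.aeval_def, Polynomial.hom_eval₂] at h5
      change Polynomial.eval₂ _ (aeval x (X s)) p = 0 at h5
      rw [Polynomial.aeval_def, Polynomial.eval₂_map]
      rw [aeval_X] at h5
      exact h5)
    have h2 := Polynomial.natDegree_map_le (f := ξM) (p := p)
    omega
end

section
variable {k : Type*} [Field k] [CharZero k] {σ : Type*} [LinearOrder σ] [Fintype σ]

theorem AlgAt.mono {P : Ideal (MvPolynomial σ k)} {D E : ℕ} (h : D ≤ E) {s : σ}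
    {g : Polynomial (supported k (Set.Iio s))} (hg : AlgAt P D s g) : AlgAt P E s g :=
  ⟨hg.1, hg.2.1, hg.2.2.1, hg.2.2.2.1.trans h, hg.2.2.2.2⟩

theorem free_bot (s : σ) : FreeAt (⊥ : Ideal (MvPolynomial σ k)) s := by
  intro p hp j
  rw [Ideal.mem_bot] at hp ⊢
  have h1 := toPh_aeval s p
  rw [hp, map_zero] at h1
  have h2 := congrArg (fun q => Polynomial.coeff q j) h1
  simp only [Polynomial.coeff_map, Polynomial.coeff_zero] at h2
  exact h2.symm

theorem lemC (M : ℕ) (F : Finset (MvPolynomial σ k)) (hF : ∀ f ∈ F, f.totalDegree ≤ M)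
    (P : Ideal (MvPolynomial σ k)) (hP : P ∈ (Ideal.span (F : Set (MvPolynomial σ k))).minimalPrimes) :
    ∃ G : List (MvPolynomial σ k), IsTriangularSet G ∧
        (P : Set (MvPolynomial σ k)) = trep G ∧
        ∀ g ∈ G, g.totalDegree ≤ EB (Fintype.card σ) M := by
  classical
  have hPp : P.IsPrime := hP.1.1
  apply lemC6
  rcases Nat.eq_zero_or_pos M with rfl | hM
  · have h1 : ∀ f ∈ F, f = 0 := by
      intro f hf
      by_contra hne
      have h2 := totalDegree_eq_zero_iff_eq_C.1 (Nat.le_zero.1 (hF f hf))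
      apply hPp.ne_top
      rw [Ideal.eq_top_iff_one]
      have h3 : f ∈ P := hP.1.2 (Ideal.subset_span hf)
      have h4 : coeff 0 f ≠ 0 := by
        intro h; apply hne; rw [h2, h, C_0]
      have h5 := P.mul_mem_left (C (coeff 0 f)⁻¹) h3
      rw [h2, coeff_zero_C, ← C_mul, inv_mul_cancel₀ h4, C_1] at h5
      exact h5
    have h2 : Ideal.span (F : Set (MvPolynomial σ k)) = ⊥ := by
      rw [Ideal.span_eq_bot]; exact h1
    have h3 : P = ⊥ := by
      rw [h2] at hP
      exact le_bot_iff.1 (hP.2 ⟨Ideal.isPrime_bot, le_rfl⟩ bot_le)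
    intro s
    left
    rw [h3]; exact free_bot s
  · obtain ⟨c, f, hf, hfP, hind⟩ := lemC12' M F hF P hP
    let L := FractionRing (MvPolynomial σ k ⧸ P)
    let x : σ → L := fun i => algebraMap (MvPolynomial σ k ⧸ P) L (Ideal.Quotient.mk P (X i))
    have hx : ∀ f, aeval x f = 0 ↔ f ∈ P := by
      intro f
      have h1 : (aeval x : MvPolynomial σ k →ₐ[k] L) =
          (IsScalarTower.toAlgHom k (MvPolynomial σ k ⧸ P) L).comp (Ideal.Quotient.mkₐ k P) := by
        apply algHom_ext
        intro i
        simp [x]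
      rw [h1, AlgHom.comp_apply, IsScalarTower.coe_toAlgHom', Ideal.Quotient.mkₐ_eq_mk,
        map_eq_zero_iff _ (IsFractionRing.injective (MvPolynomial σ k ⧸ P) L), Ideal.Quotient.eq_zero_iff_mem]
    let V := Finset.univ.filter fun s => ¬ FreeAt P s
    have hVc : V.card ≤ c := height_ge' P x hx V (by simp [V]) f hfP
    have hcardU : Fintype.card {u // FreeAt P u} + V.card = Fintype.card σ := by
      rw [Fintype.card_subtype]
      exact Finset.card_filter_add_card_filter_not _
    obtain ⟨D, hD, 𝓑, h𝓑, hcard⟩ := lemC4 P x hx hM hcardU (f ∘ Fin.castLE hVc)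
      (fun i => hf _) (fun i => AnIndep.mem hfP _) (hind.comp _ (Fin.castLE_injective hVc))
      (τ := Option {u // FreeAt P u}) (by simp)
    intro s
    by_cases hs : FreeAt P s
    · exact Or.inl hs
    · obtain ⟨g, hg⟩ := lemC5 P x hx s hs D 𝓑 h𝓑 hcard
      exact Or.inr ⟨g, hg.mono hD⟩
end

theorem preimage_final {k : Type*} [Field k] [IsAlgClosed k] [CharZero k]
    {n l : ℕ} (hn : 1 < n)
    (H : Subgroup (GL (Fin n) k)) (H' : Subgroup (GL (Fin l) k))
    (d d' m : ℕ)
    (hH : SubgroupTriRepBoundedBy H (d : ℝ))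
    (hH' : SubgroupTriRepBoundedBy H' (d' : ℝ))
    (τ : H →* GL (Fin l) k) (hτ : HomBoundedBy τ m) :
    SubgroupTriRepBoundedBy (Subgroup.map H.subtype (Subgroup.comap τ H'))
      ((n : ℝ) * ((max d (m * d') : ℕ) : ℝ) ^ (5.5 * (n : ℝ) ^ 3)) := by
  refine preFinal hn ?_ H H' d d' m hH hH' τ hτ
  intro M F hF P hP
  letI : Fintype (Fin n ×ₗ Fin n) := inferInstanceAs (Fintype (Fin n × Fin n))
  have hc : Fintype.card (Fin n ×ₗ Fin n) = n * n := by
    change Fintype.card (Fin n × Fin n) = _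
    simp
  have := lemC M F hF P hP
  rwa [hc] at this

/-- If `H ⊆ GL_n(k)` has a triangular representation bounded by `d`,
`H' ⊆ GL_l(k)` has a triangular representation bounded by `d'`, and `τ : H → GL_l(k)` is a
homomorphism bounded by `m`, then `τ⁻¹(H' ∩ τ(H))` has a triangular representation bounded by
`n·(max(d, m·d'))^(5.5n³)`. -/
theorem preimage_triRep {k : Type*} [Field k] [IsAlgClosed k] [CharZero k]
    {n l : ℕ} (hn : 1 < n)
    (H : Subgroup (GL (Fin n) k)) (H' : Subgroup (GL (Fin l) k))
    (d d' m : ℕ)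
    (hH : SubgroupTriRepBoundedBy H (d : ℝ))
    (hH' : SubgroupTriRepBoundedBy H' (d' : ℝ))
    (τ : H →* GL (Fin l) k) (hτ : HomBoundedBy τ m) :
    SubgroupTriRepBoundedBy (Subgroup.map H.subtype (Subgroup.comap τ H'))
      ((n : ℝ) * ((max d (m * d') : ℕ) : ℝ) ^ (5.5 * (n : ℝ) ^ 3)) := by
  exact preimage_final hn H H' d d' m hH hH' τ hτ
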